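/- (Escape rate) Assume (A.1)-(A.3). Let Σ = ⋃_{(i,j): M(ij)=1} [ij] and Σⁿ = ⋂_{i=0}^{n} σ⁻ⁱ Σ, and let μ_A = h_A ν_A be the Gibbs measure of φ on X = X_A. Then lim_{n→∞} (1/n) log μ_A(Σⁿ) = P(φ|_{X_M}) − P(φ). -/

import Mathlib

open Filter MeasureTheory Topology
open scoped ENNReal NNReal BigOperators

namespace TMS

variable {S : Type*}

/-- prepend a symbol to a one-sided sequence -/
def cons (a : S) (ω : ℕ → S) : ℕ → S
  | 0 => a
  | n + 1 => ω n

/-- the shift transformation -/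
def shift (ω : ℕ → S) : ℕ → S := fun n => ω (n + 1)

/-- the (one-sided) topological Markov shift with transition matrix `A` -/
def markovShift (A : S → S → Prop) : Set (ℕ → S) := {ω | ∀ n, A (ω n) (ω (n + 1))}

/-- the cylinder set of a word of length `n`, inside `X` -/
def cylW (X : Set (ℕ → S)) (n : ℕ) (w : Fin n → S) : Set (ℕ → S) :=
  {ω | ω ∈ X ∧ ∀ i : Fin n, ω i = w i}

/-- the cylinder set of a single symbol, inside `X` -/
def cyl1 (X : Set (ℕ → S)) (s : S) : Set (ℕ → S) := {ω | ω ∈ X ∧ ω 0 = s}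

/-- Birkhoff sum `S_n φ` -/
noncomputable def birkhoff (φ : (ℕ → S) → ℝ) (n : ℕ) (ω : ℕ → S) : ℝ :=
  ∑ i ∈ Finset.range n, φ (shift^[i] ω)

open Classical in
/-- the metric `d_θ` -/
noncomputable def dtheta (θ : ℝ) (ω υ : ℕ → S) : ℝ :=
  if ω = υ then 0 else θ ^ sInf {n | ω n ≠ υ n}

/-- supremum norm over `X` -/
noncomputable def supNorm (X : Set (ℕ → S)) (f : (ℕ → S) → ℝ) : ℝ :=
  sSup ((fun ω => |f ω|) '' X)

/-- `C` is a bound witnessing `[f]_k ≤ C`, i.e. `var_n f ≤ C θ^n` for all `n ≥ k`. -/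
def LipBound (X : Set (ℕ → S)) (θ : ℝ) (k : ℕ) (f : (ℕ → S) → ℝ) (C : ℝ) : Prop :=
  ∀ n, k ≤ n → ∀ ω, ω ∈ X → ∀ υ, υ ∈ X → (∀ i, i < n → ω i = υ i) →
    |f ω - f υ| ≤ C * θ ^ n

/-- the seminorm `[f]_k` -/
noncomputable def lipSemi (X : Set (ℕ → S)) (θ : ℝ) (k : ℕ) (f : (ℕ → S) → ℝ) : ℝ :=
  sInf {C | 0 ≤ C ∧ LipBound X θ k f C}

/-- the norm `‖f‖_k = ‖f‖_∞ + [f]_k` -/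
noncomputable def normK (X : Set (ℕ → S)) (θ : ℝ) (k : ℕ) (f : (ℕ → S) → ℝ) : ℝ :=
  supNorm X f + lipSemi X θ k f

/-- `φ` is summable: `Σ_{s : [s] ≠ ∅} exp (sup_{[s]} φ) < ∞` -/
def SummableOn (X : Set (ℕ → S)) (φ : (ℕ → S) → ℝ) : Prop :=
  (∀ s : S, BddAbove (φ '' cyl1 X s)) ∧
    Summable (fun s : {s : S // (cyl1 X s).Nonempty} => Real.exp (sSup (φ '' cyl1 X s.1)))

/-- finite irreducibility of a transition matrix -/
def FinitelyIrreducible (A : S → S → Prop) : Prop :=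
  ∃ F : Finset (List S), ∀ a b : S, ∃ w ∈ F, List.Chain' A (a :: (w ++ [b]))

/-- `X` contains a periodic point of the shift -/
def HasPeriodicPoint (X : Set (ℕ → S)) : Prop :=
  ∃ ω, ω ∈ X ∧ ∃ m, 0 < m ∧ shift^[m] ω = ω

/-- the Ruelle transfer operator `L_M` associated to `M` and the potential `φ` -/
noncomputable def transfer (M : S → S → Prop) (φ : (ℕ → S) → ℝ)
    (f : (ℕ → S) → ℝ) : (ℕ → S) → ℝ :=
  fun ω => ∑' a : {a : S // M a (ω 0)}, Real.exp (φ (cons a ω)) * f (cons a ω)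

section Top

variable [TopologicalSpace S]

/-- the cone `Λ^k_c` -/
def cone (X : Set (ℕ → S)) (θ : ℝ) (k : ℕ) (c : ℝ) : Set ((ℕ → S) → ℝ) :=
  {f | ContinuousOn f X ∧ (∀ ω ∈ X, 0 ≤ f ω) ∧
    ∀ ω ∈ X, ∀ υ ∈ X, (∀ i, i < k → ω i = υ i) →
      f ω ≤ Real.exp (c * dtheta θ ω υ) * f υ}

/-- the space `C_b(X)` of bounded continuous functions -/
def Cb (X : Set (ℕ → S)) : Set ((ℕ → S) → ℝ) :=
  {f | ContinuousOn f X ∧ BddAbove ((fun ω => |f ω|) '' X)}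

/-- the space `F^k_b(X)` of bounded weak-Lipschitz functions -/
def Fkb (X : Set (ℕ → S)) (θ : ℝ) (k : ℕ) : Set ((ℕ → S) → ℝ) :=
  {f | f ∈ Cb X ∧ ∃ C, LipBound X θ k f C}

end Top

/-- operator norm of `L` on the space `F` with norm `N` -/
noncomputable def opNorm (N : ((ℕ → S) → ℝ) → ℝ) (F : Set ((ℕ → S) → ℝ))
    (L : ((ℕ → S) → ℝ) → (ℕ → S) → ℝ) : ℝ :=
  sSup {r | ∃ f ∈ F, N f ≤ 1 ∧ r = N (L f)}

/-- spectral radius of `L` on `(F, N)` via the Gelfand formula -/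
noncomputable def specRad (N : ((ℕ → S) → ℝ) → ℝ) (F : Set ((ℕ → S) → ℝ))
    (L : ((ℕ → S) → ℝ) → (ℕ → S) → ℝ) : ℝ :=
  Filter.limsup (fun n : ℕ => (opNorm N F (L^[n])) ^ ((1 : ℝ) / n)) Filter.atTop

/-- the `n`-th partition function `Σ_{w ∈ Sⁿ, [w] ≠ ∅} exp (sup_{[w]} S_n φ)` -/
noncomputable def partition (X : Set (ℕ → S)) (φ : (ℕ → S) → ℝ) (n : ℕ) : ℝ≥0∞ :=
  ∑' w : {w : Fin n → S // (cylW X n w).Nonempty},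
    ENNReal.ofReal (Real.exp (sSup (birkhoff φ n '' cylW X n w.1)))

/-- `P` is the topological pressure of `φ` on `X` -/
def IsPressure (X : Set (ℕ → S)) (φ : (ℕ → S) → ℝ) (P : ℝ) : Prop :=
  Filter.Tendsto (fun n : ℕ => Real.log (partition X φ n).toReal / (n : ℝ))
    Filter.atTop (nhds P)

/-- there is an `M`-path from `a` to `b` (of length at least one) -/
def reaches (M : S → S → Prop) (a b : S) : Prop :=
  ∃ l : List S, List.Chain M a (l ++ [b])

/-- communication relation `a ↔ b` -/
def comm (M : S → S → Prop) (a b : S) : Prop :=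
  a = b ∨ (reaches M a b ∧ reaches M b a)

/-- the submatrix of `M` indexed by `T` -/
def restrictM (M : S → S → Prop) (T : Set S) : S → S → Prop :=
  fun a b => M a b ∧ a ∈ T ∧ b ∈ T

/-- support of a Borel measure -/
def msupport [TopologicalSpace S] [MeasurableSpace S] (ν : Measure (ℕ → S)) :
    Set (ℕ → S) :=
  {ω | ∀ U : Set (ℕ → S), IsOpen U → ω ∈ U → 0 < ν U}

end TMS

namespace TMS

section Cyl

variable {S : Type*}

/-- cylinder of a list -/
def CL : List S → Set (ℕ → S)
  | [] => Set.univ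
  | a :: l => {ω | ω 0 = a ∧ shift ω ∈ CL l}

lemma mem_CL_cons {a : S} {l : List S} {ω : ℕ → S} :
    ω ∈ CL (a :: l) ↔ ω 0 = a ∧ shift ω ∈ CL l := Iff.rfl

lemma shift_iter (ω : ℕ → S) (n i : ℕ) : (shift^[n] ω) i = ω (i + n) := by
  induction n generalizing ω with
  | zero => rfl
  | succ n ih => rw [Function.iterate_succ_apply, ih]; rfl

lemma mem_CL_append {l r : List S} {ω : ℕ → S} :
    ω ∈ CL (l ++ r) ↔ ω ∈ CL l ∧ shift^[l.length] ω ∈ CL r := by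
  induction l generalizing ω with
  | nil => simp [CL]
  | cons a l ih =>
    rw [List.cons_append, mem_CL_cons, ih, mem_CL_cons, List.length_cons,
      Function.iterate_succ_apply, and_assoc]

lemma mem_CL_ofFn {n : ℕ} {w : Fin n → S} {ω : ℕ → S} :
    ω ∈ CL (List.ofFn w) ↔ ∀ i : Fin n, ω i = w i := by
  induction n generalizing ω with
  | zero => simp [CL]
  | succ n ih =>
    rw [List.ofFn_succ, mem_CL_cons, ih, Fin.forall_fin_succ]
    simp [shift]

lemma mem_CL_agree {l : List S} {ω υ : ℕ → S} (h1 : ω ∈ CL l) (h2 : υ ∈ CL l) :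
    ∀ i < l.length, ω i = υ i := by
  induction l generalizing ω υ with
  | nil => simp
  | cons a l ih =>
    intro i hi
    cases i with
    | zero => rw [h1.1, h2.1]
    | succ i => exact ih h1.2 h2.2 i (by simpa using hi)

lemma shift_cons (a : S) (ω : ℕ → S) : shift (cons a ω) = ω := rfl

lemma cons_shift (ω : ℕ → S) : cons (ω 0) (shift ω) = ω := by
  funext i; cases i <;> rfl

lemma cons_mem_markov {A : S → S → Prop} {a : S} {ω : ℕ → S} (hω : ω ∈ markovShift A)
    (ha : A a (ω 0)) : cons a ω ∈ markovShift A := by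
  intro n; cases n with
  | zero => exact ha
  | succ n => exact hω n

lemma shift_mem_markov {A : S → S → Prop} {ω : ℕ → S} (hω : ω ∈ markovShift A) :
    shift ω ∈ markovShift A := fun n => hω (n + 1)

lemma shift_iter_mem_markov {A : S → S → Prop} {ω : ℕ → S} (hω : ω ∈ markovShift A) (n : ℕ) :
    shift^[n] ω ∈ markovShift A := fun i => by
  rw [shift_iter, shift_iter, add_right_comm]; exact hω _

/-- initial word -/
def pre (ω : ℕ → S) (n : ℕ) : List S := List.ofFn (fun i : Fin n => ω i)

lemma mem_CL_pre {ω υ : ℕ → S} {n : ℕ} : υ ∈ CL (pre ω n) ↔ ∀ i < n, υ i = ω i := by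
  rw [pre, mem_CL_ofFn]
  exact ⟨fun h i hi => h ⟨i, hi⟩, fun h i => h i i.2⟩

variable [TopologicalSpace S]

lemma continuous_shift : Continuous (shift : (ℕ → S) → ℕ → S) :=
  continuous_pi fun i => continuous_apply (i + 1)

lemma continuous_cons (a : S) : Continuous (cons a : (ℕ → S) → ℕ → S) :=
  continuous_pi fun i => by
    cases i with
    | zero => exact continuous_const
    | succ i => exact continuous_apply i

lemma isClopen_CL [DiscreteTopology S] (l : List S) : IsClopen (CL l) := by
  induction l with
  | nil => exact isClopen_univ
  | cons a l ih =>
    have h1 : IsClopen {ω : ℕ → S | ω 0 = a} :=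
      (isClopen_discrete {a}).preimage (continuous_apply 0)
    exact h1.inter (ih.preimage continuous_shift)

lemma exists_pre_subset [DiscreteTopology S] {O : Set (ℕ → S)} (hO : IsOpen O) {ω : ℕ → S}
    (hω : ω ∈ O) : ∃ n, ∀ m, n ≤ m → CL (pre ω m) ⊆ O := by
  obtain ⟨V, hV, hωV, hVO⟩ :=
    (PiNat.isTopologicalBasis_cylinders (fun _ : ℕ => S)).exists_subset_of_mem_open hω hO
  obtain ⟨x, n, rfl⟩ := hV
  refine ⟨n, fun m hm υ hυ => hVO ?_⟩
  rw [mem_CL_pre] at hυ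
  intro i hi
  rw [hυ i (by omega)]
  exact hωV i hi

lemma continuousOn_indicator_CL [DiscreteTopology S] {X : Set (ℕ → S)} {F : (ℕ → S) → ℝ}
    {E : Set (ℕ → S)} (hE : IsClopen E) (hF : ContinuousOn F (X ∩ E)) :
    ContinuousOn (E.indicator F) X := by
  intro x hx
  by_cases hxE : x ∈ E
  · have h1 : ContinuousWithinAt F X x := by
      have := hF x ⟨hx, hxE⟩
      rwa [continuousWithinAt_inter (hE.isOpen.mem_nhds hxE)] at this
    refine h1.congr_of_eventuallyEq ?_ (Set.indicator_of_mem hxE F)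
    filter_upwards [mem_nhdsWithin_of_mem_nhds (hE.isOpen.mem_nhds hxE)] with y hy
    exact Set.indicator_of_mem hy F
  · have h1 : ContinuousWithinAt (fun _ => (0 : ℝ)) X x := continuousWithinAt_const
    refine h1.congr_of_eventuallyEq ?_ (Set.indicator_of_notMem hxE F)
    filter_upwards [mem_nhdsWithin_of_mem_nhds (hE.compl.isOpen.mem_nhds hxE)] with y hy
    exact Set.indicator_of_notMem hy F

lemma continuousOn_of_lip [DiscreteTopology S] {X : Set (ℕ → S)} {θ C : ℝ} {k : ℕ}
    (hθ0 : 0 < θ) (hθ1 : θ < 1) {φ : (ℕ → S) → ℝ} (h : LipBound X θ k φ C) :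
    ContinuousOn φ X := by
  intro x hx
  rw [ContinuousWithinAt, Metric.tendsto_nhds]
  intro ε hε
  have ht : Tendsto (fun n : ℕ => C * θ ^ n) atTop (𝓝 0) := by
    simpa using (tendsto_pow_atTop_nhds_zero_of_lt_one hθ0.le hθ1).const_mul C
  obtain ⟨n, hn1, hn2⟩ := ((ht.eventually (gt_mem_nhds hε)).and (eventually_ge_atTop k)).exists
  have hop : CL (pre x n) ∈ 𝓝 x :=
    (isClopen_CL _).isOpen.mem_nhds (mem_CL_pre.2 fun _ _ => rfl)
  filter_upwards [self_mem_nhdsWithin, mem_nhdsWithin_of_mem_nhds hop] with y hy hy2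
  rw [Real.dist_eq]
  exact (h n hn2 y hy x hx (mem_CL_pre.1 hy2)).trans_lt hn1

end Cyl

section Transfer

variable {S : Type*} {A : S → S → Prop} {φ : (ℕ → S) → ℝ}

/-- weight of a symbol -/
noncomputable def wt (X : Set (ℕ → S)) (φ : (ℕ → S) → ℝ) (s : S) : ℝ≥0∞ :=
  ⨆ ω ∈ cyl1 X s, ENNReal.ofReal (Real.exp (φ ω))

lemma le_wt {X : Set (ℕ → S)} {ω : ℕ → S} (hω : ω ∈ X) :
    ENNReal.ofReal (Real.exp (φ ω)) ≤ wt X φ (ω 0) :=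
  le_iSup₂_of_le ω ⟨hω, rfl⟩ le_rfl

lemma tsum_wt_ne_top {X : Set (ℕ → S)} (hφ : SummableOn X φ) : ∑' s, wt X φ s ≠ ∞ := by
  have h1 : ∀ s ∉ {s : S | (cyl1 X s).Nonempty}, wt X φ s = 0 := by
    intro s hs
    simp only [wt, ENNReal.iSup_eq_zero]
    intro ω hω
    exact absurd ⟨ω, hω⟩ hs
  have h2 : ∑' s, wt X φ s = ∑' s : {s : S // (cyl1 X s).Nonempty}, wt X φ s.1 := by
    refine (tsum_subtype_eq_of_support_subset (s := {s : S | (cyl1 X s).Nonempty}) ?_).symm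
    intro s hs
    by_contra h
    exact hs (h1 s h)
  rw [h2]
  refine ne_top_of_le_ne_top hφ.2.tsum_ofReal_ne_top (ENNReal.tsum_le_tsum fun s => ?_)
  refine iSup₂_le fun ω hω => ?_
  exact ENNReal.ofReal_le_ofReal (Real.exp_le_exp.2 (le_csSup (hφ.1 s.1) ⟨ω, hω, rfl⟩))

lemma exp_le_Z {X : Set (ℕ → S)} (hφ : SummableOn X φ) {ω : ℕ → S} (hω : ω ∈ X) :
    Real.exp (φ ω) ≤ (∑' s, wt X φ s).toReal := by
  rw [← ENNReal.ofReal_le_iff_le_toReal (tsum_wt_ne_top hφ)]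
  exact (le_wt hω).trans (ENNReal.le_tsum _)

lemma summable_exp (hφ : SummableOn (markovShift A) φ) {ω : ℕ → S} (hω : ω ∈ markovShift A) :
    Summable (fun a : {a : S // A a (ω 0)} => Real.exp (φ (cons a ω))) := by
  have h1 : ∑' a : {a : S // A a (ω 0)}, ENNReal.ofReal (Real.exp (φ (cons a ω))) ≠ ∞ := by
    refine ne_top_of_le_ne_top (tsum_wt_ne_top hφ) ?_
    refine le_trans ?_ (ENNReal.tsum_comp_le_tsum_of_injective
      (Subtype.val_injective (p := fun a => A a (ω 0))) (wt (markovShift A) φ))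
    exact ENNReal.tsum_le_tsum fun a => le_wt (cons_mem_markov hω a.2)
  have h2 := ENNReal.summable_toReal h1
  exact h2.congr fun a => ENNReal.toReal_ofReal (Real.exp_pos _).le

lemma tsum_exp_le (hφ : SummableOn (markovShift A) φ) {ω : ℕ → S} (hω : ω ∈ markovShift A) :
    ∑' a : {a : S // A a (ω 0)}, Real.exp (φ (cons a ω)) ≤
      (∑' s, wt (markovShift A) φ s).toReal := by
  rw [← ENNReal.ofReal_le_iff_le_toReal (tsum_wt_ne_top hφ),
    ENNReal.ofReal_tsum_of_nonneg (fun _ => (Real.exp_pos _).le) (summable_exp hφ hω)]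
  refine le_trans ?_ (ENNReal.tsum_comp_le_tsum_of_injective
      (Subtype.val_injective (p := fun a => A a (ω 0))) (wt (markovShift A) φ))
  exact ENNReal.tsum_le_tsum fun a => le_wt (cons_mem_markov hω a.2)

lemma summable_transfer (hφ : SummableOn (markovShift A) φ) {ω : ℕ → S} (hω : ω ∈ markovShift A)
    {f : (ℕ → S) → ℝ} {c : ℝ} (hf : ∀ ω ∈ markovShift A, |f ω| ≤ c) :
    Summable (fun a : {a : S // A a (ω 0)} => Real.exp (φ (cons a ω)) * f (cons a ω)) := by
  refine Summable.of_norm_bounded ((summable_exp hφ hω).mul_right c) fun a => ?_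
  rw [norm_mul, Real.norm_of_nonneg (Real.exp_pos _).le]
  exact mul_le_mul_of_nonneg_left (hf _ (cons_mem_markov hω a.2)) (Real.exp_pos _).le

lemma transfer_add (hφ : SummableOn (markovShift A) φ) {ω : ℕ → S} (hω : ω ∈ markovShift A)
    {f g : (ℕ → S) → ℝ} {c d : ℝ} (hf : ∀ ω ∈ markovShift A, |f ω| ≤ c)
    (hg : ∀ ω ∈ markovShift A, |g ω| ≤ d) :
    transfer A φ (f + g) ω = transfer A φ f ω + transfer A φ g ω := by
  unfold transfer
  rw [← (summable_transfer hφ hω hf).tsum_add (summable_transfer hφ hω hg)]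
  refine tsum_congr fun a => ?_
  simp [mul_add]

lemma abs_transfer_le (hφ : SummableOn (markovShift A) φ) {ω : ℕ → S} (hω : ω ∈ markovShift A)
    {f : (ℕ → S) → ℝ} {c : ℝ} (hf : ∀ ω ∈ markovShift A, |f ω| ≤ c) :
    |transfer A φ f ω| ≤ (∑' s, wt (markovShift A) φ s).toReal * c := by
  have hc : 0 ≤ c := (abs_nonneg _).trans (hf ω hω)
  have h1 : ∀ a : {a : S // A a (ω 0)}, ‖Real.exp (φ (cons a ω)) * f (cons a ω)‖ ≤
      Real.exp (φ (cons a ω)) * c := fun a => by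
    rw [norm_mul, Real.norm_of_nonneg (Real.exp_pos _).le]
    exact mul_le_mul_of_nonneg_left (hf _ (cons_mem_markov hω a.2)) (Real.exp_pos _).le
  have := tsum_of_norm_bounded ((summable_exp hφ hω).mul_right c).hasSum h1
  rw [Real.norm_eq_abs] at this
  refine this.trans ?_
  rw [tsum_mul_right]
  exact mul_le_mul_of_nonneg_right (tsum_exp_le hφ hω) hc

open Classical in
lemma transfer_indicator (F : (ℕ → S) → ℝ) (a : S) (v : List S) (ω : ℕ → S) :
    transfer A φ ((CL (a :: v)).indicator F) ω =
      if ω ∈ CL v ∧ A a (ω 0) then Real.exp (φ (cons a ω)) * F (cons a ω) else 0 := by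
  unfold transfer
  have hmem : ∀ s : S, cons s ω ∈ CL (a :: v) ↔ s = a ∧ ω ∈ CL v := fun s => Iff.rfl
  split_ifs with h
  · rw [tsum_eq_single ⟨a, h.2⟩]
    · rw [Set.indicator_of_mem ((hmem a).2 ⟨rfl, h.1⟩)]
    · intro b hb
      rw [Set.indicator_of_notMem, mul_zero]
      rw [hmem]
      rintro ⟨h1, -⟩
      exact hb (Subtype.ext h1)
  · convert tsum_zero with b
    rw [Set.indicator_of_notMem, mul_zero]
    rw [hmem]
    rintro ⟨h1, h2⟩
    exact h ⟨h2, h1 ▸ b.2⟩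

end Transfer

end TMS

namespace TMS

set_option linter.unusedSectionVars false

section Meas

variable {S : Type*} [Countable S] [TopologicalSpace S] [DiscreteTopology S] [MeasurableSpace S]
  {A : S → S → Prop} {φ : (ℕ → S) → ℝ} {PA : ℝ} {h : (ℕ → S) → ℝ}
  {ν : Measure (ℕ → S)} [IsProbabilityMeasure ν]

/-- bundle of the hypotheses on the closed system used in the measurability step -/
structure Sys (A : S → S → Prop) (φ : (ℕ → S) → ℝ) (PA : ℝ) (h : (ℕ → S) → ℝ)
    (ν : Measure (ℕ → S)) : Prop where
  hφ : SummableOn (markovShift A) φ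
  hc : ContinuousOn φ (markovShift A)
  hh : h ∈ Cb (markovShift A)
  heig : ∀ ω ∈ markovShift A, transfer A φ h ω = Real.exp PA * h ω
  hX : ∀ᵐ ω ∂ν, ω ∈ markovShift A
  hdual : ∀ f ∈ Cb (markovShift A),
      ∫ ω, transfer A φ f ω ∂ν = Real.exp PA * ∫ ω, f ω ∂ν
  hnorm : ∫ ω, h ω ∂ν = 1

lemma Cb_bound {X : Set (ℕ → S)} {f : (ℕ → S) → ℝ} (hf : f ∈ Cb X) :
    ∃ c, ∀ ω ∈ X, |f ω| ≤ c := by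
  obtain ⟨c, hc⟩ := hf.2
  exact ⟨c, fun ω hω => hc ⟨ω, hω, rfl⟩⟩

lemma mem_Cb {X : Set (ℕ → S)} {f : (ℕ → S) → ℝ} (hf : ContinuousOn f X) {c : ℝ}
    (hc : ∀ ω ∈ X, |f ω| ≤ c) : f ∈ Cb X :=
  ⟨hf, c, by rintro _ ⟨ω, hω, rfl⟩; exact hc ω hω⟩

namespace Sys

lemma int_h (H : Sys A φ PA h ν) : Integrable h ν := by
  by_contra hn
  have := H.hnorm
  rw [integral_undef hn] at this
  exact zero_ne_one this

lemma int_of_bound (H : Sys A φ PA h ν) {f : (ℕ → S) → ℝ} {c : ℝ}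
    (hc : ∀ ω ∈ markovShift A, |f ω| ≤ c) (hf : AEMeasurable f ν) : Integrable f ν := by
  refine Integrable.of_bound hf.aestronglyMeasurable c ?_
  filter_upwards [H.hX] with ω hω using hc ω hω

lemma transfer_h (H : Sys A φ PA h ν) :
    transfer A φ h =ᵐ[ν] fun ω => Real.exp PA * h ω := by
  filter_upwards [H.hX] with ω hω using H.heig ω hω

lemma transfer_add_ae (H : Sys A φ PA h ν) {f : (ℕ → S) → ℝ} (hf : f ∈ Cb (markovShift A)) :
    transfer A φ (h + f) =ᵐ[ν] fun ω => Real.exp PA * h ω + transfer A φ f ω := by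
  obtain ⟨c, hc⟩ := Cb_bound hf
  obtain ⟨d, hd⟩ := Cb_bound H.hh
  filter_upwards [H.hX] with ω hω
  rw [transfer_add H.hφ hω hd hc, H.heig ω hω]

lemma add_mem (H : Sys A φ PA h ν) {f : (ℕ → S) → ℝ} (hf : f ∈ Cb (markovShift A)) :
    h + f ∈ Cb (markovShift A) := by
  obtain ⟨c, hc⟩ := Cb_bound hf
  obtain ⟨d, hd⟩ := Cb_bound H.hh
  refine mem_Cb (H.hh.1.add hf.1) (c := d + c) fun ω hω => ?_
  exact (abs_add_le _ _).trans (add_le_add (hd ω hω) (hc ω hω))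

lemma aem_of_transfer (H : Sys A φ PA h ν) {f : (ℕ → S) → ℝ} (hf : f ∈ Cb (markovShift A))
    (hL : AEMeasurable (transfer A φ f) ν) : AEMeasurable f ν := by
  by_contra hn
  obtain ⟨c, hc⟩ := Cb_bound hf
  have hLi : Integrable (transfer A φ f) ν :=
    H.int_of_bound (fun ω hω => abs_transfer_le H.hφ hω hc) hL
  have hfn : ¬ Integrable f ν := fun hi => hn hi.aemeasurable
  have hfn2 : ¬ Integrable (h + f) ν := fun hi => hfn (by
    have := hi.sub H.int_h
    simpa using this)
  have h1 := H.hdual f hf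
  have h2 := H.hdual (h + f) (H.add_mem hf)
  rw [integral_undef hfn, mul_zero] at h1
  rw [integral_undef hfn2, mul_zero, integral_congr_ae (H.transfer_add_ae hf),
    integral_add (H.int_h.const_mul _) hLi, h1, integral_const_mul, H.hnorm] at h2
  have := Real.exp_pos PA
  linarith

lemma aem_transfer (H : Sys A φ PA h ν) {f : (ℕ → S) → ℝ} (hf : f ∈ Cb (markovShift A))
    (hL : AEMeasurable f ν) : AEMeasurable (transfer A φ f) ν := by
  by_contra hn
  obtain ⟨c, hc⟩ := Cb_bound hf
  have hi : Integrable f ν := H.int_of_bound hc hL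
  have hLn : ¬ Integrable (transfer A φ f) ν := fun hi => hn hi.aemeasurable
  have hLn2 : ¬ Integrable (transfer A φ (h + f)) ν := fun hi => hLn (by
    have h3 := (hi.congr (H.transfer_add_ae hf)).sub (H.int_h.const_mul (Real.exp PA))
    refine h3.congr (ae_of_all _ fun ω => ?_)
    simp)
  have h1 := H.hdual f hf
  have h2 := H.hdual (h + f) (H.add_mem hf)
  rw [integral_undef hLn] at h1
  have hp := Real.exp_pos PA
  have h3 : ∫ ω, f ω ∂ν = 0 := by
    rcases mul_eq_zero.1 h1.symm with h | h
    · exact absurd h hp.ne'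
    · exact h
  have h4 : ∫ ω, (h + f) ω ∂ν = 1 := by
    simp only [Pi.add_apply]
    rw [integral_add H.int_h hi, H.hnorm, h3, add_zero]
  rw [integral_undef hLn2, h4] at h2
  linarith

/-- null-measurability from cylinders -/
lemma nullMeas_open (H : Sys A φ PA h ν) {P : List S → Prop}
    (hP : ∀ l, P l → NullMeasurableSet (CL l) ν) {O : Set (ℕ → S)} (hO : IsOpen O)
    (hcov : ∀ ω ∈ O, ω ∈ markovShift A → ∃ n, ∀ m, n ≤ m → P (pre ω m)) :
    NullMeasurableSet O ν := by
  have h1 : NullMeasurableSet (⋃ l ∈ {l : List S | P l ∧ CL l ⊆ O}, CL l) ν :=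
    NullMeasurableSet.biUnion (Set.to_countable _) fun l hl => hP l hl.1
  refine h1.congr ?_
  filter_upwards [H.hX] with ω hω
  apply propext
  change (ω ∈ ⋃ l ∈ {l : List S | P l ∧ CL l ⊆ O}, CL l) ↔ ω ∈ O
  constructor
  · intro hm
    simp only [Set.mem_iUnion] at hm
    obtain ⟨l, hl, hlω⟩ := hm
    exact hl.2 hlω
  · intro hm
    obtain ⟨n, hn⟩ := hcov ω hm hω
    obtain ⟨n', hn'⟩ := exists_pre_subset hO hm
    simp only [Set.mem_iUnion]
    exact ⟨pre ω (max n n'), ⟨hn _ (le_max_left _ _), hn' _ (le_max_right _ _)⟩,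
      mem_CL_pre.2 fun _ _ => rfl⟩

lemma aem_of_open (H : Sys A φ PA h ν) {E : Set (ℕ → S)} (hE : IsClopen E)
    (hO : ∀ O, IsOpen O → O ⊆ E → NullMeasurableSet O ν) {F : (ℕ → S) → ℝ}
    (hF : ContinuousOn F (markovShift A)) (h0 : ∀ ω ∉ E, F ω = 0) : AEMeasurable F ν := by
  have hEn : NullMeasurableSet E ν := hO E hE.isOpen le_rfl
  have key : ∀ c, NullMeasurableSet (F ⁻¹' Set.Ioi c) ν := by
    intro c
    obtain ⟨O, hOo, hOX⟩ := (continuousOn_iff'.1 hF) (Set.Ioi c) isOpen_Ioi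
    have h1 : NullMeasurableSet (O ∩ E) ν :=
      hO _ (hOo.inter hE.isOpen) Set.inter_subset_right
    have h2 : NullMeasurableSet ((O ∩ E) ∪ (if c < 0 then Eᶜ else ∅)) ν := by
      split_ifs
      · exact h1.union hEn.compl
      · exact h1.union MeasurableSet.empty.nullMeasurableSet
    refine h2.congr ?_
    filter_upwards [H.hX] with ω hω
    apply propext
    change (ω ∈ (O ∩ E) ∪ (if c < 0 then Eᶜ else ∅)) ↔ c < F ω
    have h3 : c < F ω ↔ ω ∈ O := by
      have : ω ∈ F ⁻¹' Set.Ioi c ∩ markovShift A ↔ ω ∈ O ∩ markovShift A := by rw [hOX]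
      simpa [hω] using this
    by_cases hωE : ω ∈ E
    · rw [h3]
      split_ifs <;> simp [hωE]
    · rw [h0 ω hωE]
      split_ifs with hc0 <;> simp [hωE, hc0]
  have : NullMeasurable F ν := by
    have : @Measurable (NullMeasurableSpace (ℕ → S) ν) ℝ _ _ F :=
      measurable_of_Ioi (fun c => key c)
    exact fun s hs => this hs
  exact this.aemeasurable

end Sys

/-- symbol with two predecessors -/
def Branch (A : S → S → Prop) (b : S) : Prop := ∃ a a', a ≠ a' ∧ A a b ∧ A a' b

lemma Branch.other {b : S} (hb : Branch A b) (a : S) : ∃ a', a' ≠ a ∧ A a' b := by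
  obtain ⟨c, d, hcd, hc, hd⟩ := hb
  by_cases h : c = a
  · exact ⟨d, fun h' => hcd (h.trans h'.symm), hd⟩
  · exact ⟨c, h, hc⟩

namespace Sys

lemma cont_cons (H : Sys A φ PA h ν) (a : S) :
    ContinuousOn (fun ω => Real.exp (φ (cons a ω))) (markovShift A ∩ {ω | A a (ω 0)}) := by
  refine Real.continuous_exp.comp_continuousOn ?_
  refine H.hc.comp (continuous_cons a).continuousOn ?_
  rintro ω ⟨h1, h2⟩
  exact cons_mem_markov h1 h2

lemma cont_cons_shift (H : Sys A φ PA h ν) (a a' b : S) (v : List S) (hab : A a' b) :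
    ContinuousOn (fun ω => Real.exp (φ (cons a' (shift ω))))
      (markovShift A ∩ CL (a :: b :: v)) := by
  refine (H.cont_cons a').comp continuous_shift.continuousOn ?_
  rintro ω ⟨h1, h2⟩
  refine ⟨shift_mem_markov h1, ?_⟩
  change A a' (shift ω 0)
  rw [h2.2.1]; exact hab

lemma nm_branch1 (H : Sys A φ PA h ν) {a b : S} (hb : Branch A b) (v : List S) :
    NullMeasurableSet (CL (a :: b :: v)) ν := by
  by_cases hab : A a b
  swap
  · refine NullMeasurableSet.of_null ?_
    refine measure_mono_null ?_ H.hX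
    intro ω hω hX
    apply hab
    have := hX 0
    rw [hω.1] at this
    rwa [show ω (0 + 1) = b from hω.2.1] at this
  obtain ⟨a', ha', ha'b⟩ := hb.other a
  set F1 : (ℕ → S) → ℝ := fun ω => Real.exp (φ (cons a' (shift ω))) with hF1
  set F2 : (ℕ → S) → ℝ := fun ω => - Real.exp (φ (cons a (shift ω))) with hF2
  set g1 := (CL (a :: b :: v)).indicator F1 with hg1
  set g2 := (CL (a' :: b :: v)).indicator F2 with hg2
  set Z := (∑' s, wt (markovShift A) φ s).toReal
  have bd : ∀ c d : S, A d b → ∀ ω ∈ markovShift A, ω ∈ CL (c :: b :: v) →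
      Real.exp (φ (cons d (shift ω))) ≤ Z := by
    intro c d hd ω hω hωC
    refine exp_le_Z H.hφ (cons_mem_markov (shift_mem_markov hω) ?_)
    rw [hωC.2.1]; exact hd
  have b1 : ∀ ω ∈ markovShift A, |g1 ω| ≤ Z := by
    intro ω hω
    by_cases hm : ω ∈ CL (a :: b :: v)
    · rw [hg1, Set.indicator_of_mem hm, hF1, abs_of_pos (Real.exp_pos _)]
      exact bd _ _ ha'b ω hω hm
    · rw [hg1, Set.indicator_of_notMem hm, abs_zero]; exact ENNReal.toReal_nonneg
  have b2 : ∀ ω ∈ markovShift A, |g2 ω| ≤ Z := by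
    intro ω hω
    by_cases hm : ω ∈ CL (a' :: b :: v)
    · rw [hg2, Set.indicator_of_mem hm, hF2, abs_neg, abs_of_pos (Real.exp_pos _)]
      exact bd _ _ hab ω hω hm
    · rw [hg2, Set.indicator_of_notMem hm, abs_zero]; exact ENNReal.toReal_nonneg
  have c1 : ContinuousOn g1 (markovShift A) :=
    continuousOn_indicator_CL (isClopen_CL _) (H.cont_cons_shift a a' b v ha'b)
  have c2 : ContinuousOn g2 (markovShift A) :=
    continuousOn_indicator_CL (isClopen_CL _) (H.cont_cons_shift a' a b v hab).neg
  have hg : g1 + g2 ∈ Cb (markovShift A) := mem_Cb (c1.add c2) (c := Z + Z) fun ω hω =>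
    (abs_add_le _ _).trans (add_le_add (b1 ω hω) (b2 ω hω))
  have hL : transfer A φ (g1 + g2) =ᵐ[ν] fun _ => (0 : ℝ) := by
    filter_upwards [H.hX] with ω hω
    rw [transfer_add H.hφ hω b1 b2, transfer_indicator, transfer_indicator]
    by_cases hm : ω ∈ CL (b :: v)
    · rw [if_pos ⟨hm, by rw [hm.1]; exact hab⟩, if_pos ⟨hm, by rw [hm.1]; exact ha'b⟩]
      simp only [hF1, hF2, shift_cons]
      ring
    · rw [if_neg (fun h => hm h.1), if_neg (fun h => hm h.1), add_zero]
  have hgm : AEMeasurable (g1 + g2) ν :=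
    H.aem_of_transfer hg ((aemeasurable_const (b := (0 : ℝ))).congr hL.symm)
  have : CL (a :: b :: v) = (g1 + g2) ⁻¹' Set.Ioi 0 := by
    ext ω
    simp only [Set.mem_preimage, Set.mem_Ioi, Pi.add_apply]
    by_cases h1 : ω ∈ CL (a :: b :: v)
    · have h2 : ω ∉ CL (a' :: b :: v) := fun h2 => ha' (h2.1.symm.trans h1.1)
      simp only [hg1, hg2, Set.indicator_of_mem h1, Set.indicator_of_notMem h2, add_zero, h1, hF1,
        true_iff]
      exact Real.exp_pos _
    · simp only [hg1, Set.indicator_of_notMem h1, zero_add, h1, false_iff, not_lt]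
      by_cases h2 : ω ∈ CL (a' :: b :: v)
      · simp only [hg2, Set.indicator_of_mem h2, hF2]
        have := Real.exp_pos (φ (cons a (shift ω)))
        linarith
      · simp only [hg2, Set.indicator_of_notMem h2, le_refl]
  rw [this]
  exact hgm.nullMeasurableSet_preimage measurableSet_Ioi

lemma one_mem_Cb (l : List S) : (CL l).indicator (fun _ => (1 : ℝ)) ∈ Cb (markovShift A) := by
  refine mem_Cb (continuousOn_indicator_CL (isClopen_CL _) continuousOn_const) (c := 1) ?_
  intro ω _
  by_cases hm : ω ∈ CL l
  · simp [hm]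
  · simp [hm]

lemma cont_LF (H : Sys A φ PA h ν) (a : S) (v : List S) :
    ContinuousOn (transfer A φ ((CL (a :: v)).indicator (fun _ => (1 : ℝ)))) (markovShift A) := by
  have hcl : IsClopen (CL v ∩ {ω | A a (ω 0)}) :=
    (isClopen_CL v).inter ((isClopen_discrete {b | A a b}).preimage (continuous_apply 0))
  have := continuousOn_indicator_CL (X := markovShift A) hcl ((H.cont_cons a).mono
    (s := markovShift A ∩ {ω | A a (ω 0)}) (t := markovShift A ∩ (CL v ∩ {ω | A a (ω 0)}))
      (fun ω hω => ⟨hω.1, hω.2.2⟩))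
  refine this.congr fun ω _ => ?_
  rw [transfer_indicator]
  by_cases hm : ω ∈ CL v ∩ {ω | A a (ω 0)}
  · rw [Set.indicator_of_mem hm, if_pos (show ω ∈ CL v ∧ A a (ω 0) from hm), mul_one]
  · rw [Set.indicator_of_notMem hm, if_neg (show ¬ (ω ∈ CL v ∧ A a (ω 0)) from hm)]

lemma nm_branch (H : Sys A φ PA h ν) {b : S} (hb : Branch A b) (p : List S) (a : S) (q : List S) :
    NullMeasurableSet (CL (a :: (p ++ b :: q))) ν := by
  induction p generalizing a q with
  | nil => exact H.nm_branch1 hb q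
  | cons c p ih =>
    set v := c :: (p ++ b :: q) with hv
    have hO : ∀ O, IsOpen O → O ⊆ CL v → NullMeasurableSet O ν := by
      intro O hOo hOv
      refine H.nullMeas_open (P := fun l => ∃ q', l = v ++ q') ?_ hOo ?_
      · rintro _ ⟨q', rfl⟩
        have := ih c (q ++ q')
        simpa [hv] using this
      · intro ω hω _
        refine ⟨v.length, fun m hm => ⟨(pre ω m).drop v.length, ?_⟩⟩
        have h1 : (pre ω m).take v.length = v := by
          have := hOv hω
          apply List.ext_getElem
          · simp [pre, hm]
          · intro i h1 h2
            have h3 : ω ∈ CL (List.ofFn v.get) := by rwa [List.ofFn_get]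
            have h4 := mem_CL_ofFn.1 h3 ⟨i, h2⟩
            simp only [pre, List.getElem_take, List.getElem_ofFn]
            simpa using h4
        conv_lhs => rw [← List.take_append_drop v.length (pre ω m), h1]
    have hL : AEMeasurable (transfer A φ ((CL (a :: v)).indicator (fun _ => (1 : ℝ)))) ν := by
      refine H.aem_of_open (isClopen_CL v) hO (H.cont_LF a v) ?_
      intro ω hω
      rw [transfer_indicator, if_neg (fun h => hω h.1)]
    have hm := H.aem_of_transfer (one_mem_Cb _) hL
    have : CL (a :: v) = (CL (a :: v)).indicator (fun _ => (1 : ℝ)) ⁻¹' Set.Ioi 0 := by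
      ext ω
      by_cases hm : ω ∈ CL (a :: v) <;> simp [hm]
    rw [List.cons_append, ← hv, this]
    exact hm.nullMeasurableSet_preimage measurableSet_Ioi

end Sys

lemma back_unique {ω : ℕ → S} (hω : ω ∈ markovShift A) (hnb : ∀ i, 1 ≤ i → ¬ Branch A (ω i))
    (p : List S) (b : S) (n : ℕ) (hch : List.IsChain A (b :: (p ++ [ω n])))
    (hn : p.length + 1 ≤ n) : b = ω (n - p.length - 1) := by
  have step : ∀ (b : S) (m : ℕ), A b (ω (m + 1)) → b = ω m := by
    intro b m hb
    by_contra hne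
    exact hnb (m + 1) (by omega) ⟨b, ω m, hne, hb, hω m⟩
  induction p generalizing b with
  | nil =>
    simp only [List.nil_append, List.isChain_cons_cons] at hch
    apply step
    simp only [List.length_nil] at *
    rw [show n - 0 - 1 + 1 = n by omega]
    exact hch.1
  | cons c p ih =>
    simp only [List.cons_append, List.isChain_cons_cons] at hch
    simp only [List.length_cons] at *
    have h1 := ih c hch.2 (by omega)
    apply step
    rw [show n - (p.length + 1) - 1 + 1 = n - p.length - 1 by omega, ← h1]
    exact hch.1

lemma exists_branch (hA : FinitelyIrreducible A) {b : S} (hb : Branch A b) {ω : ℕ → S}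
    (hω : ω ∈ markovShift A) : ∃ i, 1 ≤ i ∧ Branch A (ω i) := by
  by_contra hcon
  push Not at hcon
  obtain ⟨F, hF⟩ := hA
  set L := F.sup List.length
  obtain ⟨w, hw, hch⟩ := hF b (ω (L + 2))
  have hl : w.length ≤ L := Finset.le_sup hw
  have := back_unique hω hcon w b (L + 2) hch (by omega)
  exact hcon _ (by omega) (this ▸ hb)

lemma no_branch (hA : FinitelyIrreducible A) {M : S → S → Prop} (hMA : ∀ a b, M a b → A a b)
    (hb : ∀ b, ¬ Branch A b) {x : ℕ → S} (hx : x ∈ markovShift M) {a b : S} (hab : A a b) :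
    M a b := by
  have hxA : x ∈ markovShift A := fun n => hMA _ _ (hx n)
  obtain ⟨F, hF⟩ := hA
  set L := F.sup List.length
  obtain ⟨w, hw, hch⟩ := hF b (x (L + 2))
  have hl : w.length ≤ L := Finset.le_sup hw
  have := back_unique hxA (fun i _ => hb _) w b (L + 2) hch (by omega)
  have hm : L + 2 - w.length - 1 = (L - w.length) + 1 := by omega
  rw [hm] at this
  by_contra hM
  apply hb b
  refine ⟨a, x (L - w.length), ?_, hab, ?_⟩
  · rintro rfl
    exact hM (this ▸ hx _)
  · rw [this]; exact hxA _

lemma Sys.nm_all (H : Sys A φ PA h ν) (hA : FinitelyIrreducible A) {b : S} (hb : Branch A b)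
    {O : Set (ℕ → S)} (hO : IsOpen O) : NullMeasurableSet O ν := by
  refine H.nullMeas_open (P := fun l => ∃ a p b q, Branch A b ∧ l = a :: (p ++ b :: q)) ?_ hO ?_
  · rintro _ ⟨a, p, b, q, hb, rfl⟩
    exact H.nm_branch hb p a q
  · intro ω _ hω
    obtain ⟨i, hi, hbi⟩ := exists_branch hA hb hω
    obtain ⟨i, rfl⟩ : ∃ j, i = j + 1 := ⟨i - 1, by omega⟩
    refine ⟨i + 2, fun m hm => ?_⟩
    obtain ⟨m, rfl⟩ : ∃ j, m = j + (i + 2) := ⟨m - (i + 2), by omega⟩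
    have hmem : ω (i + 1) ∈ (pre ω (m + i + 2)).tail := by
      rw [pre, List.ofFn_succ, List.tail_cons, List.mem_ofFn]
      exact ⟨⟨i, by omega⟩, rfl⟩
    obtain ⟨p, q, hpq⟩ := List.append_of_mem hmem
    refine ⟨ω 0, p, ω (i + 1), q, hbi, ?_⟩
    rw [← hpq]
    have hpre : ∀ n, pre ω (n + 1) = ω 0 :: (pre ω (n + 1)).tail := fun n => by
      rw [pre, List.ofFn_succ]; rfl
    exact hpre (m + i + 1)

open Classical in
/-- density of the transfer operator on a cylinder -/
noncomputable def G (A : S → S → Prop) (φ : (ℕ → S) → ℝ) (a : S) (v : List S) (ω : ℕ → S) : ℝ≥0∞ :=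
  if ω ∈ CL v ∧ A a (ω 0) then ENNReal.ofReal (Real.exp (φ (cons a ω))) else 0

lemma Sys.dual (H : Sys A φ PA h ν) (hO : ∀ O : Set (ℕ → S), IsOpen O → NullMeasurableSet O ν)
    (a : S) (v : List S) :
    AEMeasurable (G A φ a v) ν ∧
    ENNReal.ofReal (Real.exp PA) * ν (CL (a :: v)) = ∫⁻ ω, G A φ a v ω ∂ν := by
  set f := (CL (a :: v)).indicator (fun _ => (1 : ℝ)) with hf
  have hfC : f ∈ Cb (markovShift A) := one_mem_Cb _
  have hNM := hO _ (isClopen_CL (a :: v)).isOpen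
  have hfm : AEMeasurable f ν := aemeasurable_const.indicator₀ hNM
  have hLm := H.aem_transfer hfC hfm
  have hG : G A φ a v = fun ω => ENNReal.ofReal (transfer A φ f ω) := by
    funext ω
    rw [hf, transfer_indicator, G]
    split_ifs <;> simp
  have hL0 : ∀ ω, 0 ≤ transfer A φ f ω := by
    intro ω
    rw [hf, transfer_indicator]
    split_ifs
    · simp only [mul_one]; exact (Real.exp_pos _).le
    · exact le_rfl
  obtain ⟨c, hc⟩ := Cb_bound hfC
  have hLi : Integrable (transfer A φ f) ν :=
    H.int_of_bound (fun ω hω => abs_transfer_le H.hφ hω hc) hLm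
  rw [hG]
  refine ⟨hLm.ennreal_ofReal, ?_⟩
  rw [← ofReal_integral_eq_lintegral_ofReal hLi (ae_of_all _ hL0), H.hdual f hfC,
    ENNReal.ofReal_mul (Real.exp_pos _).le, hf, integral_indicator₀ hNM]
  simp [Measure.real]

end Meas

end TMS

namespace TMS

set_option linter.unusedSectionVars false

section Sums

variable {S : Type*}

lemma tsum_append {m n : ℕ} (f : (Fin (m + n) → S) → ℝ≥0∞) :
    ∑' w, f w = ∑' u : Fin m → S, ∑' v : Fin n → S, f (Fin.append u v) := by
  rw [← (Fin.appendEquiv m n).tsum_eq f, ENNReal.tsum_prod']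
  rfl

lemma tsum_prod_pow (g : S → ℝ≥0∞) (n : ℕ) :
    ∑' w : Fin n → S, ∏ i, g (w i) = (∑' s, g s) ^ n := by
  induction n with
  | zero => simp
  | succ n ih =>
    rw [← (Fin.consEquiv (fun _ : Fin (n + 1) => S)).tsum_eq, ENNReal.tsum_prod', pow_succ', ← ih,
      ← ENNReal.tsum_mul_right]
    refine tsum_congr fun a => ?_
    rw [← ENNReal.tsum_mul_left]
    refine tsum_congr fun v => ?_
    rw [Fin.prod_univ_succ]
    rfl

/-- weight of a list -/
noncomputable def lw (b : S → ℝ≥0∞) (l : List S) : ℝ≥0∞ := (l.map b).prod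

lemma lw_cons (b : S → ℝ≥0∞) (a : S) (l : List S) : lw b (a :: l) = b a * lw b l := by
  simp [lw]

lemma lw_append (b : S → ℝ≥0∞) (l r : List S) : lw b (l ++ r) = lw b l * lw b r := by
  simp [lw]

lemma lw_ofFn (b : S → ℝ≥0∞) {n : ℕ} (w : Fin n → S) : lw b (List.ofFn w) = ∏ i, b (w i) := by
  simp [lw, List.map_ofFn, List.prod_ofFn]

lemma tsum_lw (b : S → ℝ≥0∞) (n : ℕ) :
    ∑' w : Fin n → S, lw b (List.ofFn w) = (∑' s, b s) ^ n := by
  rw [← tsum_prod_pow]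
  exact tsum_congr fun w => lw_ofFn b w

lemma birkhoff_succ (φ : (ℕ → S) → ℝ) (n : ℕ) (y : ℕ → S) :
    birkhoff φ (n + 1) y = φ y + birkhoff φ n (shift y) := by
  unfold birkhoff
  rw [Finset.sum_range_succ', add_comm]
  rfl

lemma birkhoff_add (φ : (ℕ → S) → ℝ) (m n : ℕ) (y : ℕ → S) :
    birkhoff φ (m + n) y = birkhoff φ m y + birkhoff φ n (shift^[m] y) := by
  unfold birkhoff
  rw [Finset.sum_range_add]
  congr 1
  refine Finset.sum_congr rfl fun i _ => ?_
  rw [← Function.iterate_add_apply, add_comm]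

lemma exp_birkhoff_le_lw {A : S → S → Prop} {φ : (ℕ → S) → ℝ} {l : List S} {y : ℕ → S}
    (hy : y ∈ markovShift A) (hyl : y ∈ CL l) :
    ENNReal.ofReal (Real.exp (birkhoff φ l.length y)) ≤ lw (wt (markovShift A) φ) l := by
  induction l generalizing y with
  | nil => simp [lw, birkhoff]
  | cons a l ih =>
    rw [List.length_cons, birkhoff_succ, Real.exp_add, ENNReal.ofReal_mul (Real.exp_pos _).le,
      lw_cons]
    refine mul_le_mul' ?_ (ih (shift_mem_markov hy) hyl.2)
    rw [← hyl.1]; exact le_wt hy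

end Sums

section Bounds

variable {S : Type*} [TopologicalSpace S] [DiscreteTopology S] [MeasurableSpace S]

/-- consequences of the dual eigen-equation -/
structure DSys (A : S → S → Prop) (φ : (ℕ → S) → ℝ) (ρ : ℝ≥0∞) (θ C : ℝ) (k : ℕ)
    (ν : Measure (ℕ → S)) : Prop where
  hθ0 : 0 < θ
  hθ1 : θ < 1
  hC : 0 ≤ C
  hk : 1 ≤ k
  hlip : LipBound (markovShift A) θ (k + 1) φ C
  hO : ∀ O : Set (ℕ → S), IsOpen O → NullMeasurableSet O ν
  hX : ∀ᵐ ω ∂ν, ω ∈ markovShift A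
  hm : ∀ a v, AEMeasurable (G A φ a v) ν
  hd : ∀ a v, ρ * ν (CL (a :: v)) = ∫⁻ ω, G A φ a v ω ∂ν

variable {A : S → S → Prop} {φ : (ℕ → S) → ℝ} {ρ : ℝ≥0∞} {θ C : ℝ} {k : ℕ}
  {ν : Measure (ℕ → S)} [IsProbabilityMeasure ν]

namespace DSys

lemma nm (H : DSys A φ ρ θ C k ν) (l : List S) : NullMeasurableSet (CL l) ν :=
  H.hO _ (isClopen_CL l).isOpen

lemma upper_gen (H : DSys A φ ρ θ C k ν) (a : S) (v : List S) (c : ℝ≥0∞)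
    (hc : ∀ ω ∈ markovShift A, ω ∈ CL v → A a (ω 0) →
      ENNReal.ofReal (Real.exp (φ (cons a ω))) ≤ c) :
    ρ * ν (CL (a :: v)) ≤ c * ν (CL v) := by
  rw [H.hd, ← lintegral_indicator_const₀ (H.nm v)]
  refine lintegral_mono_ae ?_
  filter_upwards [H.hX] with ω hω
  rw [G]
  split_ifs with h
  · rw [Set.indicator_of_mem h.1]; exact hc ω hω h.1 h.2
  · exact zero_le

lemma lower_gen (H : DSys A φ ρ θ C k ν) (a : S) (v : List S) (c : ℝ≥0∞)
    (hc : ∀ ω ∈ markovShift A, ω ∈ CL v → A a (ω 0) ∧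
      c ≤ ENNReal.ofReal (Real.exp (φ (cons a ω)))) :
    c * ν (CL v) ≤ ρ * ν (CL (a :: v)) := by
  rw [H.hd, ← lintegral_indicator_const₀ (H.nm v)]
  refine lintegral_mono_ae ?_
  filter_upwards [H.hX] with ω hω
  by_cases h : ω ∈ CL v
  · obtain ⟨h1, h2⟩ := hc ω hω h
    rw [Set.indicator_of_mem h, G, if_pos ⟨h, h1⟩]
    exact h2
  · rw [Set.indicator_of_notMem h]; exact zero_le

lemma upper1 (H : DSys A φ ρ θ C k ν) (a : S) (v : List S) :
    ρ * ν (CL (a :: v)) ≤ wt (markovShift A) φ a * ν (CL v) :=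
  H.upper_gen a v _ fun _ hω _ hA => le_wt (φ := φ) (cons_mem_markov hω hA)

lemma upper_lw (H : DSys A φ ρ θ C k ν) (l : List S) :
    ρ ^ l.length * ν (CL l) ≤ lw (wt (markovShift A) φ) l := by
  induction l with
  | nil => simp [lw, CL]
  | cons a l ih =>
    rw [List.length_cons, pow_succ, mul_assoc, lw_cons]
    calc ρ ^ l.length * (ρ * ν (CL (a :: l)))
        ≤ ρ ^ l.length * (wt (markovShift A) φ a * ν (CL l)) := mul_le_mul' le_rfl (H.upper1 a l)
      _ = wt (markovShift A) φ a * (ρ ^ l.length * ν (CL l)) := by ring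
      _ ≤ _ := by gcongr

lemma lip_cons (H : DSys A φ ρ θ C k ν) {a : S} {l r : List S} (hl : k ≤ l.length) {y : ℕ → S}
    (hy : y ∈ markovShift A) (hyl : y ∈ CL (a :: l)) {ω : ℕ → S} (hω : ω ∈ markovShift A)
    (hωv : ω ∈ CL (l ++ r)) (hA : A a (ω 0)) :
    |φ (cons a ω) - φ y| ≤ C * θ ^ (l.length + 1) := by
  refine H.hlip (l.length + 1) (by omega) _ (cons_mem_markov hω hA) _ hy ?_
  have h1 : cons a ω ∈ CL (a :: l) := ⟨rfl, (mem_CL_append.1 hωv).1⟩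
  exact mem_CL_agree h1 hyl

lemma upper2 (H : DSys A φ ρ θ C k ν) {a : S} {l r : List S} (hl : k ≤ l.length) {y : ℕ → S}
    (hy : y ∈ markovShift A) (hyl : y ∈ CL (a :: l)) :
    ρ * ν (CL (a :: (l ++ r))) ≤
      ENNReal.ofReal (Real.exp (φ y + C * θ ^ (l.length + 1))) * ν (CL (l ++ r)) := by
  refine H.upper_gen a _ _ fun ω hω h1 h2 => ENNReal.ofReal_le_ofReal (Real.exp_le_exp.2 ?_)
  have := (abs_le.1 (H.lip_cons hl hy hyl hω h1 h2)).2
  linarith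

lemma lower2 (H : DSys A φ ρ θ C k ν) {a : S} {l : List S} (hl : k ≤ l.length) {y : ℕ → S}
    (hy : y ∈ markovShift A) (hyl : y ∈ CL (a :: l)) :
    ENNReal.ofReal (Real.exp (φ y - C * θ ^ (l.length + 1))) * ν (CL l) ≤
      ρ * ν (CL (a :: l)) := by
  refine H.lower_gen a _ _ fun ω hω h1 => ?_
  have h0 : A a (ω 0) := by
    have h3 := mem_CL_agree h1 hyl.2 0 (by have := H.hk; omega)
    rw [h3, ← hyl.1]
    exact hy 0
  refine ⟨h0, ENNReal.ofReal_le_ofReal (Real.exp_le_exp.2 ?_)⟩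
  have := (abs_le.1 (H.lip_cons (r := []) hl hy hyl hω (by simpa using h1) h0)).1
  linarith

lemma upper_iter (H : DSys A φ ρ θ C k ν) (u s r : List S) (hs : s.length = k) {y : ℕ → S}
    (hy : y ∈ markovShift A) (hyl : y ∈ CL (u ++ s)) :
    ρ ^ u.length * ν (CL (u ++ (s ++ r))) ≤
      ENNReal.ofReal (Real.exp (birkhoff φ u.length y +
        C * ∑ i ∈ Finset.range u.length, θ ^ (i + 1 + k))) * ν (CL (s ++ r)) := by
  induction u generalizing y with
  | nil => simp [birkhoff]
  | cons a u ih =>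
    have h1 := ih (shift_mem_markov hy) hyl.2
    have h2 := H.upper2 (a := a) (l := u ++ s) (r := r) (by simp [hs]) hy hyl
    rw [List.append_assoc] at h2
    rw [List.length_cons, pow_succ, mul_assoc, List.cons_append]
    calc ρ ^ u.length * (ρ * ν (CL (a :: (u ++ (s ++ r)))))
        ≤ ρ ^ u.length * (ENNReal.ofReal (Real.exp (φ y + C * θ ^ ((u ++ s).length + 1)))
            * ν (CL (u ++ (s ++ r)))) := by gcongr
      _ = ENNReal.ofReal (Real.exp (φ y + C * θ ^ ((u ++ s).length + 1)))
            * (ρ ^ u.length * ν (CL (u ++ (s ++ r)))) := by ring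
      _ ≤ ENNReal.ofReal (Real.exp (φ y + C * θ ^ ((u ++ s).length + 1))) *
          (ENNReal.ofReal (Real.exp (birkhoff φ u.length (shift y) +
        C * ∑ i ∈ Finset.range u.length, θ ^ (i + 1 + k))) * ν (CL (s ++ r))) := by gcongr
      _ = _ := by
        rw [← mul_assoc, ← ENNReal.ofReal_mul (Real.exp_pos _).le, ← Real.exp_add, birkhoff_succ,
          Finset.sum_range_succ, List.length_append, hs]
        congr 3
        ring

lemma lower_iter (H : DSys A φ ρ θ C k ν) (u s : List S) (hs : s.length = k) {y : ℕ → S}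
    (hy : y ∈ markovShift A) (hyl : y ∈ CL (u ++ s)) :
      ENNReal.ofReal (Real.exp (birkhoff φ u.length y -
        C * ∑ i ∈ Finset.range u.length, θ ^ (i + 1 + k))) * ν (CL s) ≤
      ρ ^ u.length * ν (CL (u ++ s)) := by
  induction u generalizing y with
  | nil => simp [birkhoff]
  | cons a u ih =>
    have h1 := ih (shift_mem_markov hy) hyl.2
    have h2 := H.lower2 (a := a) (l := u ++ s) (by simp [hs]) hy hyl
    rw [List.length_cons, pow_succ, mul_assoc, List.cons_append]
    refine le_trans (b := ENNReal.ofReal (Real.exp (φ y - C * θ ^ ((u ++ s).length + 1))) *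
          (ENNReal.ofReal (Real.exp (birkhoff φ u.length (shift y) -
        C * ∑ i ∈ Finset.range u.length, θ ^ (i + 1 + k))) * ν (CL s))) (le_of_eq ?_)
      (le_trans (b := ENNReal.ofReal (Real.exp (φ y - C * θ ^ ((u ++ s).length + 1)))
            * (ρ ^ u.length * ν (CL (u ++ s)))) ?_ ?_)
    · rw [← mul_assoc, ← ENNReal.ofReal_mul (Real.exp_pos _).le, ← Real.exp_add, birkhoff_succ,
          Finset.sum_range_succ, List.length_append, hs]
      congr 3
      ring
    · gcongr
    · calc _ = ρ ^ u.length * (ENNReal.ofReal (Real.exp (φ y - C * θ ^ ((u ++ s).length + 1)))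
            * ν (CL (u ++ s))) := by ring
        _ ≤ _ := by gcongr

lemma sum_le (H : DSys A φ ρ θ C k ν) (n : ℕ) :
    C * ∑ i ∈ Finset.range n, θ ^ (i + 1 + k) ≤ C * (1 - θ)⁻¹ := by
  refine mul_le_mul_of_nonneg_left ?_ H.hC
  rw [← tsum_geometric_of_lt_one H.hθ0.le H.hθ1]
  refine le_trans (Finset.sum_le_sum fun i _ => ?_)
    ((summable_geometric_of_lt_one H.hθ0.le H.hθ1).sum_le_tsum (Finset.range n)
      fun i _ => pow_nonneg H.hθ0.le i)
  exact pow_le_pow_of_le_one H.hθ0.le H.hθ1.le (by omega)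

/-- distortion constant -/
noncomputable def Kc (θ C : ℝ) : ℝ≥0∞ := ENNReal.ofReal (Real.exp (C * (1 - θ)⁻¹))

lemma Kc_ne_top : Kc θ C ≠ ∞ := ENNReal.ofReal_ne_top

lemma upper_iter' (H : DSys A φ ρ θ C k ν) (u s r : List S) (hs : s.length = k) {y : ℕ → S}
    (hy : y ∈ markovShift A) (hyl : y ∈ CL (u ++ s)) :
    ρ ^ (u ++ (s ++ r)).length * ν (CL (u ++ (s ++ r))) ≤
      Kc θ C * ENNReal.ofReal (Real.exp (birkhoff φ u.length y)) *
        (lw (wt (markovShift A) φ) s * lw (wt (markovShift A) φ) r) := by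
  have h1 := H.upper_iter u s r hs hy hyl
  have h2 := H.upper_lw (s ++ r)
  rw [lw_append] at h2
  have h3 : ENNReal.ofReal (Real.exp (birkhoff φ u.length y +
        C * ∑ i ∈ Finset.range u.length, θ ^ (i + 1 + k))) ≤
      Kc θ C * ENNReal.ofReal (Real.exp (birkhoff φ u.length y)) := by
    rw [Kc, ← ENNReal.ofReal_mul (Real.exp_pos _).le, ← Real.exp_add]
    refine ENNReal.ofReal_le_ofReal (Real.exp_le_exp.2 ?_)
    have := H.sum_le u.length
    linarith
  rw [List.length_append, pow_add, mul_comm (ρ ^ u.length), mul_assoc]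
  calc _ ≤ ρ ^ (s ++ r).length * (Kc θ C * ENNReal.ofReal (Real.exp (birkhoff φ u.length y)) *
        ν (CL (s ++ r))) := mul_le_mul' le_rfl (h1.trans (mul_le_mul' h3 le_rfl))
    _ = Kc θ C * ENNReal.ofReal (Real.exp (birkhoff φ u.length y)) *
        (ρ ^ (s ++ r).length * ν (CL (s ++ r))) := by ring
    _ ≤ _ := by gcongr

lemma lower_iter' (H : DSys A φ ρ θ C k ν) (u s : List S) (hs : s.length = k) {y : ℕ → S}
    (hy : y ∈ markovShift A) (hyl : y ∈ CL (u ++ s)) :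
      ENNReal.ofReal (Real.exp (birkhoff φ u.length y)) * ν (CL s) ≤
      Kc θ C * (ρ ^ u.length * ν (CL (u ++ s))) := by
  have h1 := H.lower_iter u s hs hy hyl
  have h3 : ENNReal.ofReal (Real.exp (birkhoff φ u.length y)) ≤
      Kc θ C * ENNReal.ofReal (Real.exp (birkhoff φ u.length y -
        C * ∑ i ∈ Finset.range u.length, θ ^ (i + 1 + k)))  := by
    rw [Kc, ← ENNReal.ofReal_mul (Real.exp_pos _).le, ← Real.exp_add]
    refine ENNReal.ofReal_le_ofReal (Real.exp_le_exp.2 ?_)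
    have := H.sum_le u.length
    linarith
  calc _ ≤ _ := mul_le_mul_left h3 _
    _ ≤ _ := by rw [mul_assoc]; gcongr

lemma pos_step (H : DSys A φ ρ θ C k ν) (a b : S) (v : List S) (hab : A a b)
    (hv : ν (CL (b :: v)) ≠ 0) : ν (CL (a :: b :: v)) ≠ 0 := by
  intro h0
  apply hv
  have h1 := H.hd a (b :: v)
  rw [h0, mul_zero] at h1
  have h2 := (lintegral_eq_zero_iff' (H.hm a (b :: v))).1 h1.symm
  have h3 : ∀ᵐ ω ∂ν, ω ∉ CL (b :: v) := by
    filter_upwards [h2] with ω hω hm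
    rw [G, if_pos ⟨hm, by rw [hm.1]; exact hab⟩] at hω
    simp only [Pi.zero_apply, ENNReal.ofReal_eq_zero] at hω
    exact absurd hω (not_le.2 (Real.exp_pos _))
  simpa [ae_iff] using h3

lemma pos_chain (H : DSys A φ ρ θ C k ν) (s : S) (hs : ν (CL [s]) ≠ 0) (l : List S)
    (hl : List.IsChain A (l ++ [s])) : ν (CL (l ++ [s])) ≠ 0 := by
  induction l with
  | nil => exact hs
  | cons a l ih =>
    have h1 := ih (by rw [List.cons_append] at hl; exact hl.tail)
    cases l with
    | nil =>
      simp only [List.cons_append, List.nil_append, List.isChain_cons_cons] at hl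
      exact H.pos_step a s [] hl.1 hs
    | cons c l =>
      simp only [List.cons_append, List.isChain_cons_cons] at hl
      exact H.pos_step a c _ hl.1 h1

lemma pos_sym [Countable S] : ∃ s, ν (CL [s]) ≠ 0 := by
  by_contra hcon
  push Not at hcon
  have h1 : ν (⋃ s : S, CL [s]) = 0 := measure_iUnion_null hcon
  have h2 : (⋃ s : S, CL [s]) = (Set.univ : Set (ℕ → S)) := by
    ext ω; simp only [Set.mem_iUnion, Set.mem_univ, iff_true]
    exact ⟨ω 0, rfl, trivial⟩
  rw [h2, measure_univ] at h1
  exact one_ne_zero h1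

lemma isChain_of_mem {ω : ℕ → S} (hω : ω ∈ markovShift A) (l : List S) (hl : ω ∈ CL l) :
    List.IsChain A l := by
  induction l generalizing ω with
  | nil => exact List.isChain_nil
  | cons a l ih =>
    cases l with
    | nil => exact List.isChain_singleton _
    | cons b l =>
      rw [List.isChain_cons_cons]
      refine ⟨?_, ih (shift_mem_markov hω) hl.2⟩
      rw [← hl.1, ← hl.2.1]
      exact hω 0

lemma pos_word [Countable S] (H : DSys A φ ρ θ C k ν) (hA : FinitelyIrreducible A) {ω : ℕ → S}
    (hω : ω ∈ markovShift A) (l : List S) (hl : ω ∈ CL l) : ν (CL l) ≠ 0 := by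
  obtain ⟨s, hs⟩ := pos_sym (ν := ν)
  obtain ⟨F, hF⟩ := hA
  rcases List.eq_nil_or_concat l with rfl | ⟨l, c, rfl⟩
  · simp [CL]
  · obtain ⟨w, -, hw⟩ := hF c s
    have hw' : List.IsChain A (c :: (w ++ [s])) := hw
    have hch : List.IsChain A ((l ++ c :: w) ++ [s]) := by
      have h1 : List.IsChain A (l ++ [c]) := by
        rw [← List.concat_eq_append]; exact isChain_of_mem hω _ hl
      have h2 := h1.append_overlap (l₂ := [c]) (l₃ := w ++ [s]) (by simpa using hw') (by simp)
      simpa using h2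
    have h2 := H.pos_chain s hs _ hch
    intro h0
    apply h2
    refine measure_mono_null ?_ h0
    intro x hx
    have : (l ++ c :: w) ++ [s] = (l ++ [c]) ++ (w ++ [s]) := by simp
    rw [this] at hx
    simpa using (mem_CL_append.1 hx).1

end DSys

end Bounds

end TMS

namespace TMS

set_option linter.unusedSectionVars false

section Partition

variable {S : Type*}

/-- sup of the exponential Birkhoff sum over a cylinder, valued in `ℝ≥0∞` -/
noncomputable def Ew (M : S → S → Prop) (φ : (ℕ → S) → ℝ) (n : ℕ) (w : Fin n → S) : ℝ≥0∞ :=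
  ⨆ x ∈ cylW (markovShift M) n w, ENNReal.ofReal (Real.exp (birkhoff φ n x))

lemma le_Ew {M : S → S → Prop} (φ : (ℕ → S) → ℝ) {n : ℕ} {w : Fin n → S} {x : ℕ → S}
    (hx : x ∈ cylW (markovShift M) n w) :
    ENNReal.ofReal (Real.exp (birkhoff φ n x)) ≤ Ew M φ n w :=
  le_iSup₂ (f := fun x (_ : x ∈ cylW (markovShift M) n w) =>
    ENNReal.ofReal (Real.exp (birkhoff φ n x))) x hx

lemma markov_mono {A M : S → S → Prop} (hMA : ∀ a b, M a b → A a b) :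
    markovShift M ⊆ markovShift A := fun _ h n => hMA _ _ (h n)

lemma mem_cylW_iff {X : Set (ℕ → S)} {n : ℕ} {w : Fin n → S} {x : ℕ → S} :
    x ∈ cylW X n w ↔ x ∈ X ∧ x ∈ CL (List.ofFn w) := by
  rw [mem_CL_ofFn]; rfl

lemma Ew_le_lw {A M : S → S → Prop} (hMA : ∀ a b, M a b → A a b) (φ : (ℕ → S) → ℝ) {n : ℕ}
    (w : Fin n → S) : Ew M φ n w ≤ lw (wt (markovShift A) φ) (List.ofFn w) := by
  refine iSup₂_le fun x hx => ?_
  rw [mem_cylW_iff] at hx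
  have := exp_birkhoff_le_lw (φ := φ) (markov_mono hMA hx.1) hx.2
  rwa [List.length_ofFn] at this

lemma bdd_birkhoff {A M : S → S → Prop} (hMA : ∀ a b, M a b → A a b) {φ : (ℕ → S) → ℝ}
    (hφ : SummableOn (markovShift A) φ) (n : ℕ) (w : Fin n → S) :
    BddAbove (birkhoff φ n '' cylW (markovShift M) n w) := by
  refine ⟨∑ i ∈ Finset.range n, Real.log (∑' s, wt (markovShift A) φ s).toReal, ?_⟩
  rintro _ ⟨x, hx, rfl⟩
  refine Finset.sum_le_sum fun i _ => ?_
  have h1 := exp_le_Z hφ (shift_iter_mem_markov (markov_mono hMA hx.1) i)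
  rwa [← Real.le_log_iff_exp_le (lt_of_lt_of_le (Real.exp_pos _) h1)] at h1

lemma partition_eq {A M : S → S → Prop} (hMA : ∀ a b, M a b → A a b) {φ : (ℕ → S) → ℝ}
    (hφ : SummableOn (markovShift A) φ) (n : ℕ) :
    partition (markovShift M) φ n = ∑' w : Fin n → S, Ew M φ n w := by
  have h1 : ∀ w : Fin n → S, w ∉ {w | (cylW (markovShift M) n w).Nonempty} → Ew M φ n w = 0 := by
    intro w hw
    simp only [Set.mem_ofPred_eq, Set.not_nonempty_iff_eq_empty] at hw
    simp [Ew, hw]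
  unfold partition
  rw [← tsum_subtype_eq_of_support_subset (f := Ew M φ n)
    (s := {w | (cylW (markovShift M) n w).Nonempty})
    (fun w hw => by by_contra hc; exact hw (h1 w hc))]
  refine tsum_congr fun w => ?_
  have hmono : Monotone (fun t : ℝ => ENNReal.ofReal (Real.exp t)) := fun a b hab =>
    ENNReal.ofReal_le_ofReal (Real.exp_le_exp.2 hab)
  have hcont : Continuous (fun t : ℝ => ENNReal.ofReal (Real.exp t)) :=
    ENNReal.continuous_ofReal.comp Real.continuous_exp
  have h2 := hmono.map_csSup_of_continuousAt (A := birkhoff φ n '' cylW (markovShift M) n w.1)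
    hcont.continuousAt (w.2.image _) (bdd_birkhoff hMA hφ n w.1)
  refine h2.trans ?_
  rw [Set.image_image, sSup_image]
  rfl

lemma partition_le {A M : S → S → Prop} (hMA : ∀ a b, M a b → A a b) {φ : (ℕ → S) → ℝ}
    (hφ : SummableOn (markovShift A) φ) (n : ℕ) :
    partition (markovShift M) φ n ≤ (∑' s, wt (markovShift A) φ s) ^ n := by
  rw [partition_eq hMA hφ, ← tsum_lw]
  exact ENNReal.tsum_le_tsum fun w => Ew_le_lw hMA φ w

lemma partition_ne_top {A M : S → S → Prop} (hMA : ∀ a b, M a b → A a b) {φ : (ℕ → S) → ℝ}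
    (hφ : SummableOn (markovShift A) φ) (n : ℕ) :
    partition (markovShift M) φ n ≠ ∞ :=
  ne_top_of_le_ne_top (ENNReal.pow_ne_top (tsum_wt_ne_top hφ)) (partition_le hMA hφ n)

lemma partition_ne_zero {A M : S → S → Prop} (hMA : ∀ a b, M a b → A a b) {φ : (ℕ → S) → ℝ}
    (hφ : SummableOn (markovShift A) φ) (n : ℕ) {x : ℕ → S} (hx : x ∈ markovShift M) :
    partition (markovShift M) φ n ≠ 0 := by
  rw [partition_eq hMA hφ]
  intro h
  have h1 := (ENNReal.tsum_eq_zero.1 h) (fun i => x i)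
  have h2 := le_Ew φ (M := M) (n := n) (w := fun i => x i) (x := x) ⟨hx, fun i => rfl⟩
  rw [h1] at h2
  have : 0 < ENNReal.ofReal (Real.exp (birkhoff φ n x)) := ENNReal.ofReal_pos.2 (Real.exp_pos _)
  exact absurd h2 (not_le.2 this)

end Partition

section Decomp

variable {S : Type*}

/-- the open-system survivor set -/
def TT (M : S → S → Prop) (n : ℕ) : Set (ℕ → S) := {ω | ∀ i, i + 1 < n → M (ω i) (ω (i + 1))}

/-- symbols that start an infinite `M`-path -/
def Live (M : S → S → Prop) (s : S) : Prop := ∃ x ∈ markovShift M, x 0 = s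

lemma live_prev {M : S → S → Prop} {a b : S} (h : M a b) (hb : Live M b) : Live M a := by
  obtain ⟨x, hx, rfl⟩ := hb
  exact ⟨cons a x, cons_mem_markov hx h, rfl⟩

lemma live_split {M : S → S → Prop} {n : ℕ} {ω : ℕ → S} (hω : ω ∈ TT M n) :
    ∃ j ≤ n, (∀ i < j, Live M (ω i)) ∧ ∀ i, j ≤ i → i < n → ¬ Live M (ω i) := by
  classical
  have hex : ∃ j, j = n ∨ ¬ Live M (ω j) := ⟨n, Or.inl rfl⟩
  refine ⟨Nat.find hex, Nat.find_min' hex (Or.inl rfl), fun i hi => ?_, fun i hi => ?_⟩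
  · have := Nat.find_min hex hi
    push Not at this
    exact this.2
  · induction i, hi using Nat.le_induction with
    | base =>
      intro h
      rcases Nat.find_spec hex with h1 | h1
      · omega
      · exact h1
    | succ i hi ih =>
      intro h h2
      exact ih (by omega) (live_prev (hω i h) h2)

lemma live_of_repeat {M : S → S → Prop} {n : ℕ} {ω : ℕ → S} (hω : ω ∈ TT M n) {i p : ℕ}
    (hp : 0 < p) (hn : i + p < n) (he : ω i = ω (i + p)) : Live M (ω i) := by
  refine ⟨fun m => ω (i + m % p), fun m => ?_, by simp⟩
  show M (ω (i + m % p)) (ω (i + (m + 1) % p))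
  have hlt := Nat.mod_lt m hp
  have h1 := hω (i + m % p) (by omega)
  by_cases hc : m % p + 1 = p
  · have h2 : (m + 1) % p = 0 := by
      rw [Nat.add_mod]
      by_cases hp1 : p = 1
      · subst hp1; exact Nat.mod_one _
      · rw [Nat.mod_eq_of_lt (show 1 < p by omega), hc, Nat.mod_self]
    rw [h2, add_zero, he]
    rwa [add_assoc, hc] at h1
  · have h2 : (m + 1) % p = m % p + 1 := by
      rw [Nat.add_mod, Nat.mod_eq_of_lt (show 1 < p by omega), Nat.mod_eq_of_lt (by omega)]
    rw [h2]
    exact h1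

lemma live_word {M : S → S → Prop} {n j : ℕ} {ω : ℕ → S} (hω : ω ∈ TT M n) (hj : j ≤ n)
    (hl : ∀ i < j, Live M (ω i)) {x : ℕ → S} (hx : x ∈ markovShift M) :
    (cylW (markovShift M) j (fun i : Fin j => ω i)).Nonempty := by
  cases j with
  | zero => exact ⟨x, hx, fun i => i.elim0⟩
  | succ j =>
    obtain ⟨y, hy, hy0⟩ := hl j (by omega)
    refine ⟨fun m => if m ≤ j then ω m else y (m - j), fun m => ?_, fun i => ?_⟩
    · rcases lt_trichotomy m j with h | h | h
      · simp only [h.le, if_true, show m + 1 ≤ j by omega]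
        exact hω m (by omega)
      · subst h
        simp only [le_refl, if_true, show ¬ (m + 1 ≤ m) by omega, if_false]
        rw [← hy0, show m + 1 - m = 0 + 1 by omega]
        exact hy 0
      · simp only [show ¬ m ≤ j by omega, show ¬ m + 1 ≤ j by omega, if_false]
        rw [show m + 1 - j = (m - j) + 1 by omega]
        exact hy _
    · have := i.2
      simp only [show (i : ℕ) ≤ j by omega, if_true]

lemma TT_subset {M : S → S → Prop} {x : ℕ → S} (hx : x ∈ markovShift M) (n : ℕ) :
    TT M n ⊆ ⋃ j ∈ Finset.range (n + 1),
      ⋃ u : {u : Fin j → S // (cylW (markovShift M) j u).Nonempty},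
      ⋃ r : {r : Fin (n - j) → S // Function.Injective r},
        CL (List.ofFn u.1 ++ List.ofFn r.1) := by
  intro ω hω
  obtain ⟨j, hj, h1, h2⟩ := live_split hω
  simp only [Set.mem_iUnion]
  refine ⟨j, Finset.mem_range.2 (by omega), ⟨_, live_word hω hj h1 hx⟩,
    ⟨fun i => ω (i + j), ?_⟩, ?_⟩
  · have key : ∀ a b : ℕ, a < b → b < n - j → ω (a + j) ≠ ω (b + j) := by
      intro a b hab hb he
      refine h2 (a + j) (by omega) (by omega)
        (live_of_repeat hω (p := b - a) (by omega) (by omega) ?_)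
      rw [he]; congr 1; omega
    intro a b hab
    simp only at hab
    rcases lt_trichotomy a b with h | h | h
    · exact absurd hab (key _ _ h b.2)
    · exact h
    · exact absurd hab.symm (key _ _ h a.2)
  · rw [mem_CL_append, mem_CL_ofFn, mem_CL_ofFn]
    refine ⟨fun i => rfl, fun i => ?_⟩
    rw [shift_iter, List.length_ofFn]

lemma dead_sum {b : S → ℝ≥0∞} (hb : ∑' s, b s ≠ ∞) {Q : ℝ≥0∞} (hQ : Q ≠ 0) (hQ' : Q ≠ ∞) :
    ∃ C : ℝ≥0∞, C ≠ ∞ ∧ ∀ l : ℕ,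
      ∑' r : {r : Fin l → S // Function.Injective r}, lw b (List.ofFn r.1) ≤ C * Q ^ l := by
  classical
  have hQ2 : 0 < Q / 2 := ENNReal.half_pos hQ
  obtain ⟨F, hF⟩ : ∃ F : Finset S, ∑' s : {s // s ∉ F}, b s < Q / 2 :=
    ((ENNReal.tendsto_tsum_compl_atTop_zero hb).eventually (gt_mem_nhds hQ2)).exists
  obtain ⟨t, ht0, ht1, htZ⟩ : ∃ t : ℝ≥0∞, t ≠ 0 ∧ t ≤ 1 ∧ t * ∑' s, b s ≤ Q / 2 := by
    refine ⟨min 1 (Q / 2 / (∑' s, b s)), ?_, min_le_left _ _, ?_⟩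
    · refine (lt_min one_pos (ENNReal.div_pos hQ2.ne' hb)).ne'
    · rw [mul_comm]; exact (mul_le_mul' le_rfl (min_le_right _ _)).trans ENNReal.mul_div_le
  have htt : t ≠ ∞ := ne_top_of_le_ne_top ENNReal.one_ne_top ht1
  set g : S → ℝ≥0∞ := fun s => (if s ∈ F then t else 1) * b s with hg
  have hgs : ∑' s, g s ≤ Q := by
    have h1 : ∀ s, g s ≤ t * b s + (({s | s ∉ F} : Set S).indicator b s) := by
      intro s
      by_cases hs : s ∈ F <;> simp [hg, hs]
    calc ∑' s, g s ≤ ∑' s, (t * b s + (({s | s ∉ F} : Set S).indicator b s)) :=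
          ENNReal.tsum_le_tsum h1
      _ = t * ∑' s, b s + ∑' s : {s // s ∉ F}, b s := by
          rw [ENNReal.tsum_add, ENNReal.tsum_mul_left]
          congr 1
          exact (tsum_subtype ({s | s ∉ F} : Set S) b).symm
      _ ≤ Q / 2 + Q / 2 := add_le_add htZ hF.le
      _ = Q := ENNReal.add_halves Q
  refine ⟨(t ^ F.card)⁻¹, ENNReal.inv_ne_top.2 (pow_ne_zero _ ht0), fun l => ?_⟩
  have key : ∀ r : {r : Fin l → S // Function.Injective r},
      lw b (List.ofFn r.1) ≤ (t ^ F.card)⁻¹ * lw g (List.ofFn r.1) := by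
    intro r
    rw [lw_ofFn, lw_ofFn]
    simp only [hg, Finset.prod_mul_distrib]
    have h1 : t ^ F.card ≤ ∏ i, (if r.1 i ∈ F then t else 1) := by
      rw [Finset.prod_ite, Finset.prod_const, Finset.prod_const_one, mul_one]
      refine pow_le_pow_right_of_le_one' ht1 ?_
      refine Finset.card_le_card_of_injOn r.1 (fun i hi => ?_) r.2.injOn
      simpa using hi
    calc ∏ i, b (r.1 i) = (t ^ F.card)⁻¹ * (t ^ F.card * ∏ i, b (r.1 i)) := by
          rw [← mul_assoc, ENNReal.inv_mul_cancel (pow_ne_zero _ ht0) (ENNReal.pow_ne_top htt),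
            one_mul]
      _ ≤ _ := mul_le_mul' le_rfl (mul_le_mul' h1 le_rfl)
  calc ∑' r : {r : Fin l → S // Function.Injective r}, lw b (List.ofFn r.1)
      ≤ ∑' r : {r : Fin l → S // Function.Injective r},
          (t ^ F.card)⁻¹ * lw g (List.ofFn r.1) := ENNReal.tsum_le_tsum key
    _ = (t ^ F.card)⁻¹ * ∑' r : {r : Fin l → S // Function.Injective r},
          lw g (List.ofFn r.1) := ENNReal.tsum_mul_left
    _ ≤ (t ^ F.card)⁻¹ * ∑' r : Fin l → S, lw g (List.ofFn r) :=
          mul_le_mul' le_rfl (ENNReal.tsum_comp_le_tsum_of_injective Subtype.val_injective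
            (fun r : Fin l → S => lw g (List.ofFn r)))
    _ ≤ _ := by
          rw [tsum_lw]
          exact mul_le_mul' le_rfl (pow_le_pow_left' hgs l)

end Decomp

section UpperBound

variable {S : Type*} [Countable S] [TopologicalSpace S] [DiscreteTopology S] [MeasurableSpace S]
variable {A M : S → S → Prop} {φ : (ℕ → S) → ℝ} {ρ : ℝ≥0∞} {θ C : ℝ} {k : ℕ}
  {ν : Measure (ℕ → S)} [IsProbabilityMeasure ν]

namespace DSys

lemma live_sum1 (H : DSys A φ ρ θ C k ν) (j : ℕ) (r : List S) :
    ∑' u : {u : Fin j → S // (cylW (markovShift M) j u).Nonempty},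
      ρ ^ (j + r.length) * ν (CL (List.ofFn u.1 ++ r)) ≤
      (∑' s, wt (markovShift A) φ s) ^ j * lw (wt (markovShift A) φ) r := by
  rw [← tsum_lw, ← ENNReal.tsum_mul_right]
  refine le_trans (ENNReal.tsum_le_tsum fun u => ?_)
    (ENNReal.tsum_comp_le_tsum_of_injective Subtype.val_injective
      (fun u : Fin j → S => lw (wt (markovShift A) φ) (List.ofFn u) * lw (wt (markovShift A) φ) r))
  have := H.upper_lw (List.ofFn u.1 ++ r)
  rwa [List.length_append, List.length_ofFn, lw_append] at this

lemma live_sum2 (H : DSys A φ ρ θ C k ν) (hMA : ∀ a b, M a b → A a b)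
    (hφ : SummableOn (markovShift A) φ) (m : ℕ) (r : List S) :
    ∑' u : {u : Fin (m + k) → S // (cylW (markovShift M) (m + k) u).Nonempty},
      ρ ^ (m + k + r.length) * ν (CL (List.ofFn u.1 ++ r)) ≤
      Kc θ C * partition (markovShift M) φ m *
        (∑' s, wt (markovShift A) φ s) ^ k * lw (wt (markovShift A) φ) r := by
  classical
  set f : (Fin (m + k) → S) → ℝ≥0∞ := fun u => if (cylW (markovShift M) (m + k) u).Nonempty then
    ρ ^ (m + k + r.length) * ν (CL (List.ofFn u ++ r)) else 0 with hf
  have h1 : ∑' u : {u : Fin (m + k) → S // (cylW (markovShift M) (m + k) u).Nonempty},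
      ρ ^ (m + k + r.length) * ν (CL (List.ofFn u.1 ++ r)) ≤ ∑' u, f u := by
    refine le_trans (ENNReal.tsum_le_tsum fun u => ?_)
      (ENNReal.tsum_comp_le_tsum_of_injective Subtype.val_injective f)
    simp only [hf, if_pos u.2, le_refl]
  refine h1.trans ?_
  rw [tsum_append, partition_eq hMA hφ, ← tsum_lw, ← ENNReal.tsum_mul_left (a := Kc θ C),
    mul_assoc, ← ENNReal.tsum_mul_right]
  refine ENNReal.tsum_le_tsum fun v => ?_
  rw [← mul_assoc]
  rw [← ENNReal.tsum_mul_left, ← ENNReal.tsum_mul_right]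
  refine ENNReal.tsum_le_tsum fun s => ?_
  simp only [hf]
  split_ifs with hne
  · obtain ⟨y, hy⟩ := hne
    rw [mem_cylW_iff, List.ofFn_fin_append] at hy
    have h2 := H.upper_iter' (List.ofFn v) (List.ofFn s) r (by simp) (markov_mono hMA hy.1) hy.2
    have h3 : ENNReal.ofReal (Real.exp (birkhoff φ m y)) ≤ Ew M φ m v :=
      le_Ew φ (mem_cylW_iff.2 ⟨hy.1, (mem_CL_append.1 hy.2).1⟩)
    simp only [List.length_append, List.length_ofFn] at h2
    rw [List.ofFn_fin_append, List.append_assoc, add_assoc]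
    refine h2.trans ?_
    rw [← mul_assoc]
    exact mul_le_mul' (mul_le_mul' (mul_le_mul' le_rfl h3) le_rfl) le_rfl
  · exact zero_le

lemma live_sum (H : DSys A φ ρ θ C k ν) (hMA : ∀ a b, M a b → A a b)
    (hφ : SummableOn (markovShift A) φ) {Q C1 : ℝ≥0∞} (hQ : Q ≠ 0) (hQ' : Q ≠ ∞) (hC1 : C1 ≠ ∞)
    (hZ : ∀ m, partition (markovShift M) φ m ≤ C1 * Q ^ m) :
    ∃ C3 : ℝ≥0∞, C3 ≠ ∞ ∧ ∀ (j : ℕ) (r : List S),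
      ∑' u : {u : Fin j → S // (cylW (markovShift M) j u).Nonempty},
        ρ ^ (j + r.length) * ν (CL (List.ofFn u.1 ++ r)) ≤
      C3 * Q ^ j * lw (wt (markovShift A) φ) r := by
  set Z := ∑' s, wt (markovShift A) φ s with hZdef
  have hZt : Z ≠ ∞ := tsum_wt_ne_top hφ
  refine ⟨(1 + Z / Q) ^ k + Kc θ C * C1 * Z ^ k / Q ^ k, ?_, fun j r => ?_⟩
  · refine ENNReal.add_ne_top.2 ⟨ENNReal.pow_ne_top (ENNReal.add_ne_top.2
      ⟨ENNReal.one_ne_top, ENNReal.div_ne_top hZt hQ⟩), ENNReal.div_ne_top ?_ (pow_ne_zero _ hQ)⟩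
    exact ENNReal.mul_ne_top (ENNReal.mul_ne_top Kc_ne_top hC1) (ENNReal.pow_ne_top hZt)
  · rcases lt_or_ge j k with hj | hj
    · refine (H.live_sum1 j r).trans (mul_le_mul' ?_ le_rfl)
      rw [← hZdef]
      have : Z ^ j = (Z / Q) ^ j * Q ^ j := by
        rw [← mul_pow, ENNReal.div_mul_cancel hQ hQ']
      rw [this]
      refine mul_le_mul' (le_trans ?_ le_self_add) le_rfl
      refine (pow_le_pow_left' (le_add_self : Z / Q ≤ 1 + Z / Q) j).trans ?_
      exact pow_le_pow_right₀ le_self_add hj.le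
    · obtain ⟨m, rfl⟩ : ∃ m, j = m + k := ⟨j - k, by omega⟩
      refine (H.live_sum2 hMA hφ m r).trans (mul_le_mul' ?_ le_rfl)
      rw [← hZdef]
      calc Kc θ C * partition (markovShift M) φ m * Z ^ k
          ≤ Kc θ C * (C1 * Q ^ m) * Z ^ k := mul_le_mul' (mul_le_mul' le_rfl (hZ m)) le_rfl
        _ = Kc θ C * C1 * Z ^ k / Q ^ k * Q ^ (m + k) := by
            rw [pow_add, mul_comm (Q ^ m), ← mul_assoc _ (Q ^ k) (Q ^ m),
              ENNReal.div_mul_cancel (pow_ne_zero _ hQ) (ENNReal.pow_ne_top hQ')]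
            ring
        _ ≤ _ := mul_le_mul' le_add_self le_rfl

theorem upper_bound (H : DSys A φ ρ θ C k ν) (hMA : ∀ a b, M a b → A a b)
    (hφ : SummableOn (markovShift A) φ) {x : ℕ → S} (hx : x ∈ markovShift M)
    {Q C1 : ℝ≥0∞} (hQ : Q ≠ 0) (hQ' : Q ≠ ∞) (hC1 : C1 ≠ ∞)
    (hZ : ∀ m, partition (markovShift M) φ m ≤ C1 * Q ^ m) :
    ∃ C4 : ℝ≥0∞, C4 ≠ ∞ ∧ ∀ n : ℕ, ρ ^ n * ν (TT M n) ≤ (n + 1 : ℕ) * (C4 * Q ^ n) := by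
  obtain ⟨C2, hC2, h2⟩ := dead_sum (tsum_wt_ne_top hφ) hQ hQ'
  obtain ⟨C3, hC3, h3⟩ := H.live_sum hMA hφ hQ hQ' hC1 hZ
  refine ⟨C3 * C2, ENNReal.mul_ne_top hC3 hC2, fun n => ?_⟩
  have h4 : ∀ j ∈ Finset.range (n + 1), ρ ^ n * ν (⋃ u : {u : Fin j → S // (cylW (markovShift M) j u).Nonempty},
      ⋃ r : {r : Fin (n - j) → S // Function.Injective r},
        CL (List.ofFn u.1 ++ List.ofFn r.1)) ≤ C3 * C2 * Q ^ n := by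
    intro j hj
    have hj' : j ≤ n := by have := Finset.mem_range.1 hj; omega
    calc _ ≤ ρ ^ n * ∑' u : {u : Fin j → S // (cylW (markovShift M) j u).Nonempty},
          ∑' r : {r : Fin (n - j) → S // Function.Injective r},
            ν (CL (List.ofFn u.1 ++ List.ofFn r.1)) := by
          refine mul_le_mul' le_rfl ((measure_iUnion_le _).trans ?_)
          exact ENNReal.tsum_le_tsum fun u => measure_iUnion_le _
      _ = ∑' r : {r : Fin (n - j) → S // Function.Injective r},
          ∑' u : {u : Fin j → S // (cylW (markovShift M) j u).Nonempty},
            ρ ^ n * ν (CL (List.ofFn u.1 ++ List.ofFn r.1)) := by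
          rw [ENNReal.tsum_comm, ← ENNReal.tsum_mul_left]
          exact tsum_congr fun r => ENNReal.tsum_mul_left.symm
      _ ≤ ∑' r : {r : Fin (n - j) → S // Function.Injective r},
          C3 * Q ^ j * lw (wt (markovShift A) φ) (List.ofFn r.1) := by
          refine ENNReal.tsum_le_tsum fun r => ?_
          have := h3 j (List.ofFn r.1)
          rwa [List.length_ofFn, Nat.add_sub_cancel' hj'] at this
      _ = C3 * Q ^ j * ∑' r : {r : Fin (n - j) → S // Function.Injective r},
          lw (wt (markovShift A) φ) (List.ofFn r.1) := ENNReal.tsum_mul_left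
      _ ≤ C3 * Q ^ j * (C2 * Q ^ (n - j)) := mul_le_mul' le_rfl (h2 _)
      _ = C3 * C2 * Q ^ n := by
          rw [← Nat.add_sub_cancel' hj', pow_add]
          simp only [Nat.add_sub_cancel_left]
          ring
  calc ρ ^ n * ν (TT M n) ≤ ρ ^ n * ∑ j ∈ Finset.range (n + 1),
        ν (⋃ u : {u : Fin j → S // (cylW (markovShift M) j u).Nonempty},
          ⋃ r : {r : Fin (n - j) → S // Function.Injective r},
            CL (List.ofFn u.1 ++ List.ofFn r.1)) :=
        mul_le_mul' le_rfl ((measure_mono (TT_subset hx n)).trans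
          (measure_biUnion_finset_le _ _))
    _ ≤ ∑ j ∈ Finset.range (n + 1), C3 * C2 * Q ^ n := by
        rw [Finset.mul_sum]
        exact Finset.sum_le_sum h4
    _ = _ := by rw [Finset.sum_const, Finset.card_range, nsmul_eq_mul]

end DSys

end UpperBound

end TMS

namespace TMS

set_option linter.unusedSectionVars false

section LowerBound

variable {S : Type*} [Countable S] [TopologicalSpace S] [DiscreteTopology S] [MeasurableSpace S]
variable {A M : S → S → Prop} {φ : (ℕ → S) → ℝ} {ρ : ℝ≥0∞} {θ C : ℝ} {k : ℕ}
  {ν : Measure (ℕ → S)} [IsProbabilityMeasure ν]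

lemma mem_cylW_append {X : Set (ℕ → S)} {m k : ℕ} {v : Fin m → S} {u : Fin k → S} {x : ℕ → S} :
    x ∈ cylW X (m + k) (Fin.append v u) ↔ x ∈ X ∧ x ∈ CL (List.ofFn v ++ List.ofFn u) := by
  rw [mem_cylW_iff, List.ofFn_fin_append]

lemma Ew_append_le (hMA : ∀ a b, M a b → A a b) (m : ℕ) (v : Fin m → S) (u : Fin k → S) :
    Ew M φ (m + k) (Fin.append v u) ≤ Ew M φ m v * lw (wt (markovShift A) φ) (List.ofFn u) := by
  refine iSup₂_le fun x hx => ?_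
  rw [mem_cylW_append, mem_CL_append, List.length_ofFn] at hx
  rw [birkhoff_add, Real.exp_add, ENNReal.ofReal_mul (Real.exp_pos _).le]
  refine mul_le_mul' (le_Ew φ (mem_cylW_iff.2 ⟨hx.1, hx.2.1⟩)) ?_
  have := exp_birkhoff_le_lw (φ := φ)
    (shift_iter_mem_markov (markov_mono hMA hx.1) m) hx.2.2
  rwa [List.length_ofFn] at this

/-- the part of a cylinder kept when the word is `M`-extendable -/
def DD (M : S → S → Prop) {m k : ℕ} (v : Fin m → S) (u : Fin k → S) : Set (ℕ → S) :=
  {ω | ω ∈ CL (List.ofFn v ++ List.ofFn u) ∧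
    (cylW (markovShift M) (m + k) (Fin.append v u)).Nonempty}

lemma DD_of {m k : ℕ} {v : Fin m → S} {u : Fin k → S}
    (h : (cylW (markovShift M) (m + k) (Fin.append v u)).Nonempty) :
    DD M v u = CL (List.ofFn v ++ List.ofFn u) := by
  ext ω; simp [DD, h]

lemma DD_not {m k : ℕ} {v : Fin m → S} {u : Fin k → S}
    (h : ¬ (cylW (markovShift M) (m + k) (Fin.append v u)).Nonempty) :
    DD M v u = ∅ := by
  ext ω; simp [DD, h]

lemma DD_subset {m k n : ℕ} (hn : n ≤ m) (v : Fin m → S) (u : Fin k → S) :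
    DD M v u ⊆ TT M n := by
  rintro ω ⟨h1, y, hy⟩ i hi
  rw [mem_cylW_append] at hy
  have h3 := mem_CL_agree h1 hy.2
  simp only [List.length_append, List.length_ofFn] at h3
  rw [h3 i (by omega), h3 (i + 1) (by omega)]
  exact hy.1 i

namespace DSys

lemma sum_DD (H : DSys A φ ρ θ C k ν) {m n : ℕ} (hn : n ≤ m) (u : Fin k → S) :
    ∑' v : Fin m → S, ν (DD M v u) ≤ ν (TT M n) := by
  classical
  rw [← measure_iUnion₀]
  · exact measure_mono (Set.iUnion_subset fun v => DD_subset hn v u)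
  · intro v v' hvv
    refine Disjoint.aedisjoint (Set.disjoint_left.2 ?_)
    rintro ω ⟨h1, -⟩ ⟨h2, -⟩
    apply hvv
    funext i
    rw [← (mem_CL_ofFn.1 (mem_CL_append.1 h1).1) i, (mem_CL_ofFn.1 (mem_CL_append.1 h2).1) i]
  · intro v
    by_cases h : (cylW (markovShift M) (m + k) (Fin.append v u)).Nonempty
    · rw [DD_of h]; exact H.nm _
    · rw [DD_not h]; exact nullMeasurableSet_empty

lemma Ew_le_meas (H : DSys A φ ρ θ C k ν) (hA : FinitelyIrreducible A)
    (hMA : ∀ a b, M a b → A a b) (m : ℕ) (v : Fin m → S) (u : Fin k → S) :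
    Ew M φ (m + k) (Fin.append v u) ≤
      (if ν (CL (List.ofFn u)) = 0 then 0 else
        lw (wt (markovShift A) φ) (List.ofFn u) * Kc θ C / ν (CL (List.ofFn u))) *
      (ρ ^ m * ν (DD M v u)) := by
  refine iSup₂_le fun x hx => ?_
  rw [DD_of ⟨x, hx⟩]
  rw [mem_cylW_append] at hx
  have hxA := markov_mono hMA hx.1
  have hx2 := mem_CL_append.1 hx.2
  rw [List.length_ofFn] at hx2
  have hpos := H.pos_word hA (shift_iter_mem_markov hxA m) _ hx2.2
  rw [if_neg hpos]
  rw [birkhoff_add, Real.exp_add, ENNReal.ofReal_mul (Real.exp_pos _).le]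
  have h1 := exp_birkhoff_le_lw (φ := φ) (shift_iter_mem_markov hxA m) hx2.2
  have h2 := H.lower_iter' (List.ofFn v) (List.ofFn u) (by simp) hxA hx.2
  rw [List.length_ofFn] at h1 h2
  have h3 : ENNReal.ofReal (Real.exp (birkhoff φ m x)) ≤
      Kc θ C * (ρ ^ m * ν (CL (List.ofFn v ++ List.ofFn u))) / ν (CL (List.ofFn u)) := by
    rw [ENNReal.le_div_iff_mul_le (Or.inl hpos) (Or.inl (measure_ne_top _ _))]
    exact h2
  refine (mul_le_mul' h3 h1).trans (le_of_eq ?_)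
  simp only [div_eq_mul_inv]
  ring

lemma one_step (H : DSys A φ ρ θ C k ν) (hA : FinitelyIrreducible A)
    (hMA : ∀ a b, M a b → A a b) (hφ : SummableOn (markovShift A) φ) {ε : ℝ≥0∞} (hε : ε ≠ 0) :
    ∃ C5 : ℝ≥0∞, C5 ≠ ∞ ∧ ∀ m n, n ≤ m → partition (markovShift M) φ (m + k) ≤
      ε * partition (markovShift M) φ m + C5 * (ρ ^ m * ν (TT M n)) := by
  classical
  set lb : (Fin k → S) → ℝ≥0∞ := fun u => lw (wt (markovShift A) φ) (List.ofFn u) with hlb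
  have hsum : ∑' u, lb u ≠ ∞ := by
    rw [hlb, tsum_lw]; exact ENNReal.pow_ne_top (tsum_wt_ne_top hφ)
  obtain ⟨U, hU⟩ : ∃ U : Finset (Fin k → S), ∑' u : {u // u ∉ U}, lb u < ε :=
    ((ENNReal.tendsto_tsum_compl_atTop_zero hsum).eventually
      (gt_mem_nhds (pos_iff_ne_zero.2 hε))).exists
  have hlbt : ∀ u, lb u ≠ ∞ := fun u => ENNReal.ne_top_of_tsum_ne_top hsum u
  set c : (Fin k → S) → ℝ≥0∞ := fun u => if ν (CL (List.ofFn u)) = 0 then 0 else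
        lb u * Kc θ C / ν (CL (List.ofFn u)) with hc
  have hct : ∀ u, c u ≠ ∞ := by
    intro u
    simp only [hc]
    split_ifs with h
    · exact ENNReal.zero_ne_top
    · exact ENNReal.div_ne_top (ENNReal.mul_ne_top (hlbt u) Kc_ne_top) h
  refine ⟨∑ u ∈ U, c u, ENNReal.sum_ne_top.2 fun u _ => hct u, fun m n hn => ?_⟩
  have hpt : ∀ (v : Fin m → S) (u : Fin k → S), Ew M φ (m + k) (Fin.append v u) ≤
      Ew M φ m v * (({u | u ∉ U} : Set (Fin k → S)).indicator lb u) +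
      (if u ∈ U then c u else 0) * (ρ ^ m * ν (DD M v u)) := by
    intro v u
    by_cases hu : u ∈ U
    · rw [if_pos hu]
      exact (H.Ew_le_meas hA hMA m v u).trans le_add_self
    · rw [if_neg hu, Set.indicator_of_mem (show u ∈ ({u | u ∉ U} : Set (Fin k → S)) from hu)]
      exact (Ew_append_le hMA m v u).trans le_self_add
  rw [partition_eq hMA hφ, partition_eq hMA hφ, tsum_append]
  calc ∑' (v : Fin m → S) (u : Fin k → S), Ew M φ (m + k) (Fin.append v u)
      ≤ ∑' (v : Fin m → S) (u : Fin k → S),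
        (Ew M φ m v * (({u | u ∉ U} : Set (Fin k → S)).indicator lb u) +
          (if u ∈ U then c u else 0) * (ρ ^ m * ν (DD M v u))) :=
        ENNReal.tsum_le_tsum fun v => ENNReal.tsum_le_tsum fun u => hpt v u
    _ = (∑' v : Fin m → S, Ew M φ m v * ∑' u : {u // u ∉ U}, lb u) +
        ∑' (u : Fin k → S) (v : Fin m → S),
          (if u ∈ U then c u else 0) * (ρ ^ m * ν (DD M v u)) := by
        rw [ENNReal.tsum_comm (f := fun (u : Fin k → S) (v : Fin m → S) =>
          (if u ∈ U then c u else 0) * (ρ ^ m * ν (DD M v u))), ← ENNReal.tsum_add]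
        refine tsum_congr fun v => ?_
        rw [ENNReal.tsum_add, ENNReal.tsum_mul_left]
        congr 2
        exact (tsum_subtype ({u | u ∉ U} : Set (Fin k → S)) lb).symm
    _ ≤ ε * ∑' v : Fin m → S, Ew M φ m v +
        ∑' (u : Fin k → S), (if u ∈ U then c u else 0) * (ρ ^ m * ν (TT M n)) := by
        refine add_le_add ?_ (ENNReal.tsum_le_tsum fun u => ?_)
        · rw [ENNReal.tsum_mul_right, mul_comm]
          exact mul_le_mul' hU.le le_rfl
        · rw [ENNReal.tsum_mul_left, ENNReal.tsum_mul_left]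
          exact mul_le_mul' le_rfl (mul_le_mul' le_rfl (H.sum_DD hn u))
    _ = _ := by
        rw [ENNReal.tsum_mul_right]
        congr 2
        rw [tsum_eq_sum (s := U) (fun u hu => if_neg hu)]
        exact Finset.sum_congr rfl fun u hu => if_pos hu

theorem lower_bound (H : DSys A φ ρ θ C k ν) (hA : FinitelyIrreducible A)
    (hMA : ∀ a b, M a b → A a b) (hφ : SummableOn (markovShift A) φ) {ε : ℝ≥0∞} (hε : ε ≠ 0)
    (hε1 : ε ≤ 1) :
    ∃ C5 : ℝ≥0∞, C5 ≠ ∞ ∧ ∀ n j, partition (markovShift M) φ (n + j * k) ≤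
      ε ^ j * partition (markovShift M) φ n + C5 * (2 + ρ ^ k) ^ j * (ρ ^ n * ν (TT M n)) := by
  obtain ⟨C5, hC5, h5⟩ := H.one_step hA hMA hφ hε
  refine ⟨C5, hC5, fun n j => ?_⟩
  induction j with
  | zero => simp
  | succ j ih =>
    have h1 := h5 (n + j * k) n (by omega)
    rw [show n + (j + 1) * k = n + j * k + k by ring]
    refine h1.trans ?_
    set L := 2 + ρ ^ k with hL
    have h2 : ρ ^ (n + j * k) ≤ ρ ^ n * L ^ j := by
      rw [pow_add, mul_comm j, pow_mul]
      exact mul_le_mul' le_rfl (pow_le_pow_left' le_add_self j)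
    have h3 : L ^ j + L ^ j ≤ L ^ (j + 1) := by
      rw [pow_succ, ← mul_two]
      exact mul_le_mul' le_rfl le_self_add
    calc ε * partition (markovShift M) φ (n + j * k) + C5 * (ρ ^ (n + j * k) * ν (TT M n))
        ≤ ε * (ε ^ j * partition (markovShift M) φ n + C5 * L ^ j * (ρ ^ n * ν (TT M n))) +
          C5 * ((ρ ^ n * L ^ j) * ν (TT M n)) :=
          add_le_add (mul_le_mul' le_rfl ih)
            (mul_le_mul' le_rfl (mul_le_mul' h2 le_rfl))
      _ ≤ ε ^ (j + 1) * partition (markovShift M) φ n +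
          1 * (C5 * L ^ j * (ρ ^ n * ν (TT M n))) + C5 * ((ρ ^ n * L ^ j) * ν (TT M n)) := by
          rw [mul_add, ← mul_assoc, ← pow_succ']
          exact add_le_add (add_le_add le_rfl (mul_le_mul' hε1 le_rfl)) le_rfl
      _ = ε ^ (j + 1) * partition (markovShift M) φ n +
          C5 * (L ^ j + L ^ j) * (ρ ^ n * ν (TT M n)) := by ring
      _ ≤ _ := add_le_add le_rfl (mul_le_mul' (mul_le_mul' le_rfl h3) le_rfl)

end DSys

end LowerBound

end TMS

namespace TMS

section RealAnalysis

lemma real_const_div (c : ℝ) : Tendsto (fun n : ℕ => c / (n : ℝ)) atTop (𝓝 0) :=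
  tendsto_const_div_atTop_nhds_zero_nat c

lemma real_log_div : Tendsto (fun n : ℕ => Real.log ((n : ℝ) + 1) / (n : ℝ)) atTop (𝓝 0) := by
  have h1 : Tendsto (fun x : ℝ => Real.log x / x) atTop (𝓝 0) := by
    simpa using (Real.isLittleO_log_id_atTop).tendsto_div_nhds_zero
  have h2 : Tendsto (fun n : ℕ => ((n : ℝ) + 1)) atTop atTop :=
    tendsto_atTop_add_const_right _ _ tendsto_natCast_atTop_atTop
  have h3 := h1.comp h2
  have h4 : Tendsto (fun n : ℕ => 1 + 1 / (n : ℝ)) atTop (𝓝 (1 + 0)) :=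
    tendsto_const_nhds.add (real_const_div 1)
  have h5 := h3.mul h4
  rw [zero_mul] at h5
  refine h5.congr' ?_
  filter_upwards [eventually_gt_atTop 0] with n hn
  have : (0 : ℝ) < n := by exact_mod_cast hn
  simp only [Function.comp]
  field_simp

lemma real_lower {z t : ℕ → ℝ} {PM PA : ℝ} {k : ℕ} (hz : ∀ n, 0 < z n) (ht : ∀ n, 0 ≤ t n)
    (hPM : Tendsto (fun n : ℕ => Real.log (z n) / (n : ℝ)) atTop (𝓝 PM))
    (hL : ∀ ε : ℝ, 0 < ε → ε ≤ 1 → ∃ C5 : ℝ, 0 ≤ C5 ∧ ∀ n j, z (n + j * k) ≤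
      ε ^ j * z n + C5 * (2 + Real.exp PA ^ k) ^ j * (Real.exp PA ^ n * t n)) :
    ∃ G : ℝ, 0 ≤ G ∧ ∀ δ : ℝ, 0 < δ → δ < 1 → ∀ᶠ n : ℕ in atTop, 0 < t n ∧
      PM - PA - δ * (2 + 2 * G) ≤ Real.log (t n) / n := by
  obtain ⟨C5, hC5, h5⟩ := hL (Real.exp (-(1 + k * (|PM| + 1)))) (Real.exp_pos _)
    (Real.exp_le_one_iff.2 (by
      have : (0 : ℝ) ≤ k * (|PM| + 1) := by positivity
      linarith))
  set L : ℝ := 2 + Real.exp PA ^ k with hLdef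
  have hL1 : 1 ≤ L := by have := pow_pos (Real.exp_pos PA) k; linarith
  have hL0 : 0 < L := by linarith
  set K : ℝ := C5 + 1 with hK
  have hK0 : 0 < K := by linarith
  set G : ℝ := k * (|PM| + 1) + Real.log L with hG
  have hlogL : 0 ≤ Real.log L := Real.log_nonneg hL1
  have hkP : (0 : ℝ) ≤ k * (|PM| + 1) := by positivity
  refine ⟨G, by positivity, fun δ hδ hδ1 => ?_⟩
  have hev : ∀ᶠ n : ℕ in atTop, (n : ℝ) * (PM - δ) ≤ Real.log (z n) ∧
      Real.log (z n) ≤ n * (PM + δ) := by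
    filter_upwards [hPM.eventually (lt_mem_nhds (show PM - δ < PM by linarith)),
      hPM.eventually (gt_mem_nhds (show PM < PM + δ by linarith)), eventually_gt_atTop 0]
      with n h1 h2 hn
    have hn' : (0 : ℝ) < n := by exact_mod_cast hn
    rw [lt_div_iff₀ hn'] at h1
    rw [div_lt_iff₀ hn'] at h2
    constructor <;> linarith
  obtain ⟨N, hN⟩ := eventually_atTop.1 hev
  have hsm : ∀ᶠ n : ℕ in atTop, (2 * G + Real.log (2 * K)) / n < δ :=
    (real_const_div _).eventually (gt_mem_nhds hδ)
  filter_upwards [eventually_ge_atTop N, hsm, eventually_gt_atTop 0] with n hnN hsmn hn0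
  have hn' : (0 : ℝ) < n := by exact_mod_cast hn0
  obtain ⟨j, hj1, hj2⟩ : ∃ j : ℕ, 2 * δ * n + 1 ≤ j ∧ (j : ℝ) ≤ 2 * δ * n + 2 := by
    refine ⟨⌈2 * δ * n⌉₊ + 1, ?_, ?_⟩
    · push_cast
      linarith [Nat.le_ceil (2 * δ * n)]
    · push_cast
      linarith [Nat.ceil_lt_add_one (show 0 ≤ 2 * δ * (n : ℝ) by positivity)]
  have hj0 : (0 : ℝ) ≤ j := Nat.cast_nonneg j
  have hm := (hN (n + j * k) (by nlinarith [Nat.zero_le (j * k)])).1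
  have hnu := (hN n hnN).2
  push_cast at hm
  have hPMabs : -(|PM| + 1) ≤ PM - δ := by have := neg_abs_le PM; linarith
  have hjk : -((j : ℝ) * (k * (|PM| + 1))) ≤ j * k * (PM - δ) := by
    have h1 : (0 : ℝ) ≤ j * k := by positivity
    have := mul_le_mul_of_nonneg_left hPMabs h1
    linarith
  have hhalf : Real.exp (-(1 + k * (|PM| + 1))) ^ j * z n ≤ z (n + j * k) / 2 := by
    have e1 : Real.exp (-(1 + k * (|PM| + 1))) ^ j * z n =
        Real.exp (j * (-(1 + k * (|PM| + 1))) + Real.log (z n)) := by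
      rw [Real.exp_add, Real.exp_log (hz n), ← Real.exp_nat_mul]
    have e2 : Real.exp (-1) ≤ 1 / 2 := by
      rw [Real.exp_neg, one_div]
      have := Real.add_one_le_exp (1 : ℝ)
      exact inv_anti₀ (by norm_num) (by linarith)
    have e3 : Real.exp (j * (-(1 + k * (|PM| + 1))) + Real.log (z n)) ≤
        Real.exp (-1) * z (n + j * k) := by
      rw [← Real.exp_log (hz (n + j * k)), ← Real.exp_add, Real.exp_le_exp]
      nlinarith
    rw [e1]
    refine e3.trans ?_
    have := mul_le_mul_of_nonneg_right e2 (hz (n + j * k)).le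
    linarith
  have hmain : z (n + j * k) ≤ 2 * K * L ^ j * (Real.exp PA ^ n * t n) := by
    have h1 := h5 n j
    have h2 : C5 * L ^ j * (Real.exp PA ^ n * t n) ≤ K * L ^ j * (Real.exp PA ^ n * t n) := by
      have : C5 ≤ K := by linarith
      have := ht n
      gcongr
    linarith
  have htpos : 0 < t n := by
    rcases (ht n).lt_or_eq with h | h
    · exact h
    · rw [← h, mul_zero, mul_zero] at hmain
      exact absurd hmain (not_le.2 (hz _))
  refine ⟨htpos, ?_⟩
  have hlog : Real.log (z (n + j * k)) ≤ Real.log (2 * K) + j * Real.log L + (n * PA + Real.log (t n)) := by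
    have h1 := Real.log_le_log (hz _) hmain
    rw [Real.log_mul (by positivity) (by positivity), Real.log_mul (by positivity) (by positivity),
      Real.log_mul (x := Real.exp PA ^ n) (by positivity) (by positivity), Real.log_pow,
      Real.log_pow, Real.log_exp] at h1
    exact h1
  have hjG : (j : ℝ) * G ≤ (2 * δ * n + 2) * G :=
    mul_le_mul_of_nonneg_right hj2 (by positivity)
  rw [div_lt_iff₀ hn'] at hsmn
  rw [le_div_iff₀ hn']
  have hjG' : (j : ℝ) * G = j * (k * (|PM| + 1)) + j * Real.log L := by rw [hG]; ring
  nlinarith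

lemma real_upper {z t : ℕ → ℝ} {PM PA : ℝ} (hz : ∀ n, 0 < z n) (ht : ∀ᶠ n in atTop, 0 < t n)
    (hPM : Tendsto (fun n : ℕ => Real.log (z n) / (n : ℝ)) atTop (𝓝 PM))
    (hU : ∀ Q C1 : ℝ, 0 < Q → 0 ≤ C1 → (∀ m, z m ≤ C1 * Q ^ m) → ∃ C4 : ℝ, 0 ≤ C4 ∧
      ∀ n : ℕ, Real.exp PA ^ n * t n ≤ ((n : ℝ) + 1) * (C4 * Q ^ n))
    {δ : ℝ} (hδ : 0 < δ) :
    ∀ᶠ n : ℕ in atTop, Real.log (t n) / n ≤ PM - PA + 3 * δ := by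
  set Q := Real.exp (PM + δ) with hQ
  have hQ0 : 0 < Q := Real.exp_pos _
  have hev : ∀ᶠ n : ℕ in atTop, z n ≤ Q ^ n := by
    filter_upwards [hPM.eventually (gt_mem_nhds (show PM < PM + δ by linarith)),
      eventually_gt_atTop 0] with n h2 hn
    have hn' : (0 : ℝ) < n := by exact_mod_cast hn
    rw [div_lt_iff₀ hn'] at h2
    rw [hQ, ← Real.exp_nat_mul, ← Real.log_le_iff_le_exp (hz n)]
    linarith
  obtain ⟨N, hN⟩ := eventually_atTop.1 hev
  have hsn : 0 ≤ ∑ m ∈ Finset.range N, z m / Q ^ m :=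
    Finset.sum_nonneg fun m _ => div_nonneg (hz m).le (pow_pos hQ0 m).le
  obtain ⟨C4, hC4, h4⟩ := hU Q (1 + ∑ m ∈ Finset.range N, z m / Q ^ m) hQ0 (by linarith) (by
    intro m
    rcases le_or_gt N m with h | h
    · have h1 := hN m h
      have h2 := pow_pos hQ0 m
      nlinarith
    · have h1 : z m / Q ^ m ≤ ∑ m ∈ Finset.range N, z m / Q ^ m :=
        Finset.single_le_sum (f := fun m => z m / Q ^ m)
          (fun m _ => div_nonneg (hz m).le (pow_pos hQ0 m).le) (Finset.mem_range.2 h)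
      rw [← div_le_iff₀ (pow_pos hQ0 m)]
      linarith)
  have hK0 : 0 < C4 + 1 := by linarith
  filter_upwards [ht, real_log_div.eventually (gt_mem_nhds hδ),
    (real_const_div (Real.log (C4 + 1))).eventually (gt_mem_nhds hδ), eventually_gt_atTop 0]
    with n htn h1 h2 hn
  have hn' : (0 : ℝ) < n := by exact_mod_cast hn
  rw [div_lt_iff₀ hn'] at h1 h2
  rw [div_le_iff₀ hn']
  have h5 : Real.exp PA ^ n * t n ≤ ((n : ℝ) + 1) * ((C4 + 1) * Q ^ n) := by
    refine (h4 n).trans ?_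
    have := pow_pos hQ0 n
    gcongr
    linarith
  have h6 := Real.log_le_log (by positivity) h5
  rw [Real.log_mul (by positivity) (by positivity), Real.log_mul (by positivity) (by positivity),
    Real.log_mul (by positivity) (by positivity), Real.log_pow, Real.log_pow, Real.log_exp, hQ,
    Real.log_exp] at h6
  nlinarith

lemma real_final {z t s : ℕ → ℝ} {PM PA m M' : ℝ} {k : ℕ} (hz : ∀ n, 0 < z n) (ht : ∀ n, 0 ≤ t n)
    (hPM : Tendsto (fun n : ℕ => Real.log (z n) / (n : ℝ)) atTop (𝓝 PM))
    (hL : ∀ ε : ℝ, 0 < ε → ε ≤ 1 → ∃ C5 : ℝ, 0 ≤ C5 ∧ ∀ n j, z (n + j * k) ≤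
      ε ^ j * z n + C5 * (2 + Real.exp PA ^ k) ^ j * (Real.exp PA ^ n * t n))
    (hU : ∀ Q C1 : ℝ, 0 < Q → 0 ≤ C1 → (∀ m, z m ≤ C1 * Q ^ m) → ∃ C4 : ℝ, 0 ≤ C4 ∧
      ∀ n : ℕ, Real.exp PA ^ n * t n ≤ ((n : ℝ) + 1) * (C4 * Q ^ n))
    (hm : 0 < m) (hM' : 0 < M') (hs1 : ∀ n, m * t n ≤ s n) (hs2 : ∀ n, s n ≤ M' * t n) :
    Tendsto (fun n : ℕ => Real.log (s (n + 2)) / (n : ℝ)) atTop (𝓝 (PM - PA)) := by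
  obtain ⟨G, hG, hlow⟩ := real_lower hz ht hPM hL
  have htp : ∀ᶠ n in atTop, 0 < t n := by
    filter_upwards [hlow (1 / 2) (by norm_num) (by norm_num)] with n h using h.1
  have hlogt : Tendsto (fun n : ℕ => Real.log (t n) / (n : ℝ)) atTop (𝓝 (PM - PA)) := by
    refine tendsto_order.2 ⟨fun a ha => ?_, fun a ha => ?_⟩
    · set δ := min (1 / 2) ((PM - PA - a) / 2 / (2 + 2 * G)) with hδ
      have hδ0 : 0 < δ := lt_min (by norm_num) (div_pos (by linarith) (by linarith))
      have hδ1 : δ < 1 := (min_le_left _ _).trans_lt (by norm_num)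
      have hδ2 : δ * (2 + 2 * G) ≤ (PM - PA - a) / 2 := by
        rw [← le_div_iff₀ (by linarith)]; exact min_le_right _ _
      filter_upwards [hlow δ hδ0 hδ1] with n hn
      linarith [hn.2]
    · filter_upwards [real_upper (δ := (a - (PM - PA)) / 6) hz htp hPM hU (by linarith)] with n hn
      linarith
  have hlogs : Tendsto (fun n : ℕ => Real.log (s n) / (n : ℝ)) atTop (𝓝 (PM - PA)) := by
    have h1 := (real_const_div (Real.log m)).add hlogt
    have h2 := (real_const_div (Real.log M')).add hlogt
    rw [zero_add] at h1 h2
    refine tendsto_of_tendsto_of_tendsto_of_le_of_le' h1 h2 ?_ ?_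
    · filter_upwards [htp] with n hn
      rw [← add_div, ← Real.log_mul hm.ne' hn.ne']
      exact div_le_div_of_nonneg_right (Real.log_le_log (by positivity) (hs1 n)) (Nat.cast_nonneg n)
    · filter_upwards [htp] with n hn
      rw [← add_div, ← Real.log_mul hM'.ne' hn.ne']
      exact div_le_div_of_nonneg_right (Real.log_le_log
        (lt_of_lt_of_le (by positivity) (hs1 n)) (hs2 n)) (Nat.cast_nonneg n)
  have h1 := hlogs.comp (tendsto_add_atTop_nat 2)
  have h4 : Tendsto (fun n : ℕ => 1 + 2 / (n : ℝ)) atTop (𝓝 (1 + 0)) :=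
    tendsto_const_nhds.add (real_const_div 2)
  have h5 := h1.mul h4
  rw [add_zero, mul_one] at h5
  refine h5.congr' ?_
  filter_upwards [eventually_gt_atTop 0] with n hn
  have : (0 : ℝ) < n := by exact_mod_cast hn
  simp only [Function.comp]
  push_cast
  field_simp

end RealAnalysis

end TMS

namespace TMS

section Final

variable {S : Type*} [Countable S] [TopologicalSpace S] [DiscreteTopology S] [MeasurableSpace S]

lemma isOpen_TT (M : S → S → Prop) (n : ℕ) : IsOpen (TT M n) := by
  have h : TT M n = ⋂ i ∈ Finset.range n, {ω : ℕ → S | i + 1 < n → M (ω i) (ω (i + 1))} := by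
    ext ω
    simp only [TT, Set.mem_iInter, Set.mem_ofPred_eq, Finset.mem_range]
    exact ⟨fun h i _ => h i, fun h i hi => h i (by omega) hi⟩
  rw [h]
  refine isOpen_biInter_finset fun i _ => ?_
  have hc : Continuous (fun ω : ℕ → S => (ω i, ω (i + 1))) := by fun_prop
  exact (isOpen_discrete {p : S × S | i + 1 < n → M p.1 p.2}).preimage hc

theorem DSys.final {A M : S → S → Prop} {φ : (ℕ → S) → ℝ} {PA PM θ C m M' : ℝ} {k : ℕ}
    {ν : Measure (ℕ → S)} [IsProbabilityMeasure ν]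
    (H : DSys A φ (ENNReal.ofReal (Real.exp PA)) θ C k ν) (hA : FinitelyIrreducible A)
    (hMA : ∀ a b, M a b → A a b) (hφ : SummableOn (markovShift A) φ) {x : ℕ → S}
    (hx : x ∈ markovShift M) (hPM : IsPressure (markovShift M) φ PM) {h : (ℕ → S) → ℝ}
    (hm : 0 < m) (hb : ∀ ω ∈ markovShift A, m ≤ h ω ∧ h ω ≤ M') :
    Tendsto (fun n : ℕ => Real.log ((ν.withDensity (fun ω => ENNReal.ofReal (h ω)))
        (TT M (n + 2))).toReal / (n : ℝ)) atTop (𝓝 (PM - PA)) := by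
  set ρ := ENNReal.ofReal (Real.exp PA) with hρ
  have hρt : ρ ≠ ∞ := ENNReal.ofReal_ne_top
  have hρr : ρ.toReal = Real.exp PA := ENNReal.toReal_ofReal (Real.exp_pos _).le
  have hZt := partition_ne_top hMA hφ
  have hM' : 0 < M' := by
    have := hb x (markov_mono hMA hx); linarith
  have hμ : ∀ n, ENNReal.ofReal m * ν (TT M n) ≤
      (ν.withDensity (fun ω => ENNReal.ofReal (h ω))) (TT M n) ∧
      (ν.withDensity (fun ω => ENNReal.ofReal (h ω))) (TT M n) ≤ ENNReal.ofReal M' * ν (TT M n) := by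
    intro n
    have hT := H.hO _ (isOpen_TT M n)
    rw [withDensity_apply₀ _ hT, ← setLIntegral_const, ← setLIntegral_const]
    have hX := ae_restrict_of_ae (s := TT M n) H.hX
    constructor
    · refine lintegral_mono_ae ?_
      filter_upwards [hX] with ω hω using ENNReal.ofReal_le_ofReal (hb ω hω).1
    · refine lintegral_mono_ae ?_
      filter_upwards [hX] with ω hω using ENNReal.ofReal_le_ofReal (hb ω hω).2
  refine real_final (z := fun n => (partition (markovShift M) φ n).toReal)
    (t := fun n => (ν (TT M n)).toReal)
    (s := fun n => ((ν.withDensity (fun ω => ENNReal.ofReal (h ω))) (TT M n)).toReal) (k := k)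
    (m := m) (M' := M')
    (fun n => ENNReal.toReal_pos (partition_ne_zero hMA hφ n hx) (hZt n))
    (fun n => ENNReal.toReal_nonneg) hPM ?_ ?_ hm hM' ?_ ?_
  · intro ε hε hε1
    obtain ⟨C5, hC5, h5⟩ := H.lower_bound (M := M) hA hMA hφ (ε := ENNReal.ofReal ε)
      (ENNReal.ofReal_pos.2 hε).ne' (ENNReal.ofReal_le_one.2 hε1)
    refine ⟨C5.toReal, ENNReal.toReal_nonneg, fun n j => ?_⟩
    have hL : (2 + ρ ^ k : ℝ≥0∞) ≠ ∞ :=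
      ENNReal.add_ne_top.2 ⟨ENNReal.ofNat_ne_top, ENNReal.pow_ne_top hρt⟩
    have e1 : ENNReal.ofReal ε ^ j * partition (markovShift M) φ n ≠ ∞ :=
      ENNReal.mul_ne_top (ENNReal.pow_ne_top ENNReal.ofReal_ne_top) (hZt n)
    have e2 : C5 * (2 + ρ ^ k) ^ j * (ρ ^ n * ν (TT M n)) ≠ ∞ :=
      ENNReal.mul_ne_top (ENNReal.mul_ne_top hC5 (ENNReal.pow_ne_top hL))
        (ENNReal.mul_ne_top (ENNReal.pow_ne_top hρt) (measure_ne_top _ _))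
    have h6 := ENNReal.toReal_mono (ENNReal.add_ne_top.2 ⟨e1, e2⟩) (h5 n j)
    rw [ENNReal.toReal_add e1 e2] at h6
    simp only [ENNReal.toReal_mul, ENNReal.toReal_pow, ENNReal.toReal_ofReal hε.le,
      ENNReal.toReal_add ENNReal.ofNat_ne_top (ENNReal.pow_ne_top hρt), hρr,
      ENNReal.toReal_ofNat] at h6
    exact h6
  · intro Q C1 hQ hC1 hZ
    obtain ⟨C4, hC4, h4⟩ := H.upper_bound (M := M) hMA hφ hx (Q := ENNReal.ofReal Q)
      (C1 := ENNReal.ofReal C1) (ENNReal.ofReal_pos.2 hQ).ne' ENNReal.ofReal_ne_top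
      ENNReal.ofReal_ne_top (by
        intro i
        rw [← ENNReal.ofReal_toReal (hZt i), ← ENNReal.ofReal_pow hQ.le, ← ENNReal.ofReal_mul hC1]
        exact ENNReal.ofReal_le_ofReal (hZ i))
    refine ⟨C4.toReal, ENNReal.toReal_nonneg, fun n => ?_⟩
    have h6 := ENNReal.toReal_mono (ENNReal.mul_ne_top (ENNReal.natCast_ne_top _)
      (ENNReal.mul_ne_top hC4 (ENNReal.pow_ne_top ENNReal.ofReal_ne_top))) (h4 n)
    simp only [ENNReal.toReal_mul, ENNReal.toReal_pow, ENNReal.toReal_ofReal hQ.le, hρr,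
      ENNReal.toReal_natCast] at h6
    push_cast at h6
    exact h6
  · intro n
    have h1 := (hμ n).2
    have h2 := ENNReal.toReal_mono (ne_top_of_le_ne_top
      (ENNReal.mul_ne_top ENNReal.ofReal_ne_top (measure_ne_top _ _)) h1) (hμ n).1
    rwa [ENNReal.toReal_mul, ENNReal.toReal_ofReal hm.le] at h2
  · intro n
    have h2 := ENNReal.toReal_mono
      (ENNReal.mul_ne_top ENNReal.ofReal_ne_top (measure_ne_top _ _)) (hμ n).2
    rwa [ENNReal.toReal_mul, ENNReal.toReal_ofReal hM'.le] at h2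

end Final

end TMS

/-- escape rate: under (A.1)-(A.3), with `μ_A = h_A ν_A` the Gibbs
measure of `φ` on `X_A` and `Σⁿ = ⋂_{i=0}^n σ⁻ⁱ Σ`, `Σ = ⋃_{M(ij)=1} [ij]`,
`lim (1/n) log μ_A(Σⁿ) = P(φ|_{X_M}) - P(φ)`. -/
theorem stmt17 {S : Type*} [Countable S] [TopologicalSpace S] [DiscreteTopology S]
    [MeasurableSpace S]
    (A M : S → S → Prop) (hMA : ∀ a b, M a b → A a b)
    (hA : TMS.FinitelyIrreducible A)
    (θ : ℝ) (hθ0 : 0 < θ) (hθ1 : θ < 1) (k : ℕ) (hk : 1 ≤ k)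
    (φ : (ℕ → S) → ℝ) (hφ : TMS.SummableOn (TMS.markovShift A) φ)
    (hφlip : ∃ C, TMS.LipBound (TMS.markovShift A) θ (k + 1) φ C)
    (hper : TMS.HasPeriodicPoint (TMS.markovShift M))
    (PA PM : ℝ) (hPA : TMS.IsPressure (TMS.markovShift A) φ PA)
    (hPM : TMS.IsPressure (TMS.markovShift M) φ PM)
    -- the RPF triplet `(λ_A, h_A, ν_A)` for the closed system
    (hfun : (ℕ → S) → ℝ) (hhk : hfun ∈ TMS.Fkb (TMS.markovShift A) θ k)
    (hbdd : ∃ m M' : ℝ, 0 < m ∧ ∀ ω ∈ TMS.markovShift A, m ≤ hfun ω ∧ hfun ω ≤ M')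
    (heig : ∀ ω ∈ TMS.markovShift A,
      TMS.transfer A φ hfun ω = Real.exp PA * hfun ω)
    (νA : Measure (ℕ → S)) [IsProbabilityMeasure νA]
    (hνX : νA (TMS.markovShift A)ᶜ = 0)
    (hdual : ∀ f ∈ TMS.Cb (TMS.markovShift A),
      ∫ ω, TMS.transfer A φ f ω ∂νA = Real.exp PA * ∫ ω, f ω ∂νA)
    (hnorm : ∫ ω, hfun ω ∂νA = 1) :
    Filter.Tendsto
      (fun n : ℕ =>
        Real.log ((νA.withDensity (fun ω => ENNReal.ofReal (hfun ω)))
          {ω : ℕ → S | ∀ i ≤ n, M (ω i) (ω (i + 1))}).toReal / (n : ℝ))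
      Filter.atTop (nhds (PM - PA)) := by
  obtain ⟨C0, hC0⟩ := hφlip
  obtain ⟨x, hx, -⟩ := hper
  obtain ⟨m, M', hm, hb⟩ := hbdd
  have hX : ∀ᵐ ω ∂νA, ω ∈ TMS.markovShift A := hνX
  have HS : TMS.Sys A φ PA hfun νA :=
    ⟨hφ, TMS.continuousOn_of_lip hθ0 hθ1 hC0, hhk.1, heig, hX, hdual, hnorm⟩
  by_cases hbr : ∃ b, TMS.Branch A b
  · obtain ⟨b, hbr⟩ := hbr
    have hO := fun O (h : IsOpen O) => HS.nm_all hA hbr h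
    have hlip : TMS.LipBound (TMS.markovShift A) θ (k + 1) φ (max C0 0) := by
      intro n hn ω hω υ hυ h
      refine (hC0 n hn ω hω υ hυ h).trans ?_
      exact mul_le_mul_of_nonneg_right (le_max_left _ _) (pow_pos hθ0 n).le
    have HD : TMS.DSys A φ (ENNReal.ofReal (Real.exp PA)) θ (max C0 0) k νA :=
      ⟨hθ0, hθ1, le_max_right _ _, hk, hlip, hO, hX, fun a v => (HS.dual hO a v).1,
        fun a v => (HS.dual hO a v).2⟩
    have h1 := HD.final hA hMA hφ hx hPM hm hb
    have h2 : ∀ n : ℕ, {ω : ℕ → S | ∀ i ≤ n, M (ω i) (ω (i + 1))} = TMS.TT M (n + 2) := by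
      intro n
      ext ω
      exact ⟨fun h i hi => h i (by omega), fun h i hi => h i (by omega)⟩
    simp only [h2]
    exact h1
  · push Not at hbr
    have hMeq : M = A := by
      funext a b
      exact propext ⟨hMA a b, fun h => TMS.no_branch hA hMA hbr hx h⟩
    subst hMeq
    have hP : PM = PA := tendsto_nhds_unique hPM hPA
    have h0 : ∀ n : ℕ, (νA.withDensity (fun ω => ENNReal.ofReal (hfun ω)))
          {ω : ℕ → S | ∀ i ≤ n, M (ω i) (ω (i + 1))} = 1 := by
      intro n
      have hae : ∀ᵐ ω ∂(νA.withDensity (fun ω => ENNReal.ofReal (hfun ω))),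
          ω ∈ {ω : ℕ → S | ∀ i ≤ n, M (ω i) (ω (i + 1))} := by
        refine (withDensity_absolutelyContinuous νA _).ae_le ?_
        filter_upwards [hX] with ω hω i _ using hω i
      rw [measure_eq_measure_of_null_sdiff (Set.subset_univ _) (by
        rw [← Set.compl_eq_univ_sdiff]; exact hae), withDensity_apply _ MeasurableSet.univ,
        Measure.restrict_univ, ← ofReal_integral_eq_lintegral_ofReal HS.int_h, hnorm,
        ENNReal.ofReal_one]
      filter_upwards [hX] with ω hω using hm.le.trans (hb ω hω).1
    simp only [h0, hP, sub_self]
    simp
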